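/- Let G be a minimal counterexample, let v be a vertex of degree at least 9, and let x be a neighbor of v of degree 7 such that x has exactly four neighbors of degree 5, these four degree-5 neighbors of x do not form a path in G, and v is adjacent to two of them. Then the two neighbors of v that are consecutive to x in the cyclic order around v both have degree 5, and each of them has at least three neighbors of degree at least 7. -/

import Mathlib

open SimpleGraph

variable {V : Type}

/-- The involution of the darts of a graph reversing each dart. -/
def dartRev (G : SimpleGraph V) : Equiv.Perm G.Dart :=
  Function.Involutive.toPerm SimpleGraph.Dart.symm SimpleGraph.Dart.symm_involutive

/-- The face permutation of a rotation system `σ`: it sends a dart `(u,v)` to `σ (v,u)`. -/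
def facePerm {G : SimpleGraph V} (σ : Equiv.Perm G.Dart) : Equiv.Perm G.Dart :=
  (dartRev G).trans σ

/-- The setoid on `α` whose classes are the orbits (cycles) of a permutation of `α`. -/
def orbitSetoid {α : Type*} (f : Equiv.Perm α) : Setoid α :=
  ⟨f.SameCycle, ⟨fun x => Equiv.Perm.SameCycle.refl f x, fun h => h.symm, fun h h' => h.trans h'⟩⟩

/-- The number of faces of a rotation system: the number of orbits of the face permutation. -/
noncomputable def numFaces {G : SimpleGraph V} (σ : Equiv.Perm G.Dart) : ℕ :=
  Nat.card (Quotient (orbitSetoid (facePerm σ)))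

/-- The number of darts in the face (orbit of the face permutation) containing the dart `d`. -/
noncomputable def faceSize {G : SimpleGraph V} (σ : Equiv.Perm G.Dart) (d : G.Dart) : ℕ :=
  Nat.card {e : G.Dart // (facePerm σ).SameCycle d e}

/-- `σ` is a rotation system on `G`: every dart and its image share their first vertex, and
the `σ`-orbit of every dart consists of all darts sharing its first vertex. -/
structure IsRotationSystem (G : SimpleGraph V) (σ : Equiv.Perm G.Dart) : Prop where
  fst_eq : ∀ d : G.Dart, (σ d).toProd.1 = d.toProd.1
  orbit_eq : ∀ d e : G.Dart, d.toProd.1 = e.toProd.1 → σ.SameCycle d e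

/-- The degree of a vertex. -/
noncomputable def deg (G : SimpleGraph V) (v : V) : ℕ := Nat.card (G.neighborSet v)

/-- A plane triangulation: a finite connected simple graph on at least 4 vertices equipped with
a rotation system satisfying Euler's formula `|V| - |E| + F = 2` in which every face consists of
exactly 3 darts. -/
structure IsPlaneTriangulation [Fintype V] (G : SimpleGraph V) (σ : Equiv.Perm G.Dart) :
    Prop where
  connected : G.Connected
  four_le_card : 4 ≤ Fintype.card V
  rot : IsRotationSystem G σ
  euler : Fintype.card V + numFaces σ = Nat.card G.edgeSet + 2
  face_size_eq : ∀ d : G.Dart, faceSize σ d = 3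

/-- A proper 5-coloring (colors `0,...,4` standing for `1,...,5`). -/
def Proper5 (G : SimpleGraph V) (c : V → Fin 5) : Prop :=
  ∀ ⦃u w : V⦄, G.Adj u w → c u ≠ c w

/-- A finite simple graph is planar if it is isomorphic to a subgraph of a plane triangulation. -/
def IsPlanar [Fintype V] (G : SimpleGraph V) : Prop :=
  ∃ (W : Type) (iW : Fintype W) (T : SimpleGraph W) (σ : Equiv.Perm T.Dart),
    @IsPlaneTriangulation W iW T σ ∧ ∃ f : G →g T, Function.Injective f

/-- `w` is the neighbor of `v` following `u` in the cyclic (counterclockwise) order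
around `v` given by the rotation system `σ`. -/
def NextNbr {G : SimpleGraph V} (σ : Equiv.Perm G.Dart) (v u w : V) : Prop :=
  ∃ h : G.Adj v u, (σ ⟨(v, u), h⟩).toProd.2 = w

/-- A minimal counterexample: a plane triangulation admitting no proper 5-coloring with some
color class of size at most `|V|/6`, while every planar graph on fewer vertices admits one. -/
def IsMinimalCounterexample [Fintype V] (G : SimpleGraph V) (σ : Equiv.Perm G.Dart) : Prop :=
  IsPlaneTriangulation G σ ∧
  (¬ ∃ c : V → Fin 5, Proper5 G c ∧
      ∃ k : Fin 5, 6 * Nat.card {v : V | c v = k} ≤ Fintype.card V) ∧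
  (∀ (W : Type) [Fintype W] (H : SimpleGraph W), IsPlanar H →
      Fintype.card W < Fintype.card V →
      ∃ c : W → Fin 5, Proper5 H c ∧
        ∃ k : Fin 5, 6 * Nat.card {w : W | c w = k} ≤ Fintype.card W)

section helpers
open Classical

/-- The sum of an edge function over the darts at a vertex. -/
noncomputable def bdry [Fintype V] (G : SimpleGraph V) (ω : Sym2 V → ZMod 2) (v : V) : ZMod 2 :=
  ∑ d : G.Dart, if d.toProd.1 = v then ω d.edge else 0

theorem bdry_add [Fintype V] (G : SimpleGraph V) (ω ω' : Sym2 V → ZMod 2) (v : V) :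
    bdry G (ω + ω') v = bdry G ω v + bdry G ω' v := by
  unfold bdry
  rw [← Finset.sum_add_distrib]
  refine Finset.sum_congr rfl fun d _ => ?_
  split_ifs <;> simp

theorem bdry_single [Fintype V] (G : SimpleGraph V) {u w : V} (h : G.Adj u w) (v : V) :
    bdry G (Pi.single s(u, w) 1) v = (Pi.single u 1 : V → ZMod 2) v + (Pi.single w 1 : V → ZMod 2) v := by
  unfold bdry
  have hne := h.ne
  have key : ∀ d : G.Dart, (if d.toProd.1 = v then (Pi.single s(u, w) (1 : ZMod 2) :
      Sym2 V → ZMod 2) d.edge else 0) =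
      (if d = ⟨(u, w), h⟩ then (if u = v then 1 else 0) else 0) +
      (if d = ⟨(w, u), h.symm⟩ then (if w = v then 1 else 0) else 0) := by
    rintro ⟨⟨a, b⟩, hd⟩
    have hab := hd.ne
    simp only [Pi.single_apply, SimpleGraph.Dart.edge, SimpleGraph.Dart.mk.injEq, Prod.mk.injEq,
      Sym2.eq_iff, Sym2.mk]
    split_ifs <;> grind
  rw [Finset.sum_congr rfl fun d _ => key d, Finset.sum_add_distrib]
  simp [Pi.single_apply, eq_comm]

/-- Vanishing of first homology mod 2. -/
theorem face_fun [Fintype V] {G : SimpleGraph V} {σ : Equiv.Perm G.Dart}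
    (hT : IsPlaneTriangulation G σ) (ω : Sym2 V → ZMod 2) (hω : ∀ v, bdry G ω v = 0) :
    ∃ f : G.Dart → ZMod 2, (∀ d, f (facePerm σ d) = f d) ∧
      ∀ d, f d + f d.symm = ω d.edge := by
  let Q := Quotient (orbitSetoid (facePerm σ))
  have : Fintype Q := Fintype.ofFinite _
  have : Fintype G.edgeSet := Fintype.ofFinite _
  let E := G.edgeSet
  let ed : G.Dart → E := fun d => ⟨d.edge, d.edge_mem⟩
  let T : (E → ZMod 2) →ₗ[ZMod 2] (V → ZMod 2) :=
    { toFun := fun g v => ∑ d : G.Dart, if d.toProd.1 = v then g (ed d) else 0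
      map_add' := by
        intro g g'
        funext v
        simp only [Pi.add_apply]
        rw [← Finset.sum_add_distrib]
        refine Finset.sum_congr rfl fun d _ => ?_
        split_ifs <;> simp
      map_smul' := by
        intro r g
        funext v
        simp [Finset.mul_sum] }
  let D : (Q → ZMod 2) →ₗ[ZMod 2] (E → ZMod 2) :=
    { toFun := fun g e => ∑ d : G.Dart, if d.edge = e.1 then g (Quotient.mk _ d) else 0
      map_add' := by
        intro g g'
        funext v
        simp only [Pi.add_apply]
        rw [← Finset.sum_add_distrib]
        refine Finset.sum_congr rfl fun d _ => ?_
        split_ifs <;> simp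
      map_smul' := by
        intro r g
        funext v
        simp [Finset.mul_sum] }
  have hface : ∀ d : G.Dart, (Quotient.mk (orbitSetoid (facePerm σ)) (facePerm σ d)) =
      Quotient.mk _ d := by
    intro d
    apply Quotient.sound
    exact (Equiv.Perm.SameCycle.refl (facePerm σ) d).apply_left
  have hfs : ∀ d : G.Dart, facePerm σ d.symm = σ d := by
    intro d
    simp [facePerm, dartRev]
  have hDval : ∀ (g : Q → ZMod 2) (d : G.Dart),
      D g (ed d) = g (Quotient.mk _ d) + g (Quotient.mk _ d.symm) := by
    intro g d
    change (∑ d' : G.Dart, if d'.edge = d.edge then g (Quotient.mk _ d') else 0) = _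
    rw [← Finset.sum_filter, SimpleGraph.Dart.edge_fiber, Finset.sum_pair]
    exact (SimpleGraph.Dart.symm_ne d).symm
  have hsub : LinearMap.range D ≤ LinearMap.ker T := by
    rintro _ ⟨g, rfl⟩
    rw [LinearMap.mem_ker]
    funext v
    change (∑ d : G.Dart, if d.toProd.1 = v then D g (ed d) else 0) = 0
    have h1 : ∀ d : G.Dart, (if d.toProd.1 = v then D g (ed d) else 0) =
        (if d.toProd.1 = v then g (Quotient.mk _ d) else 0) +
        (if (σ d).toProd.1 = v then g (Quotient.mk _ (σ d)) else 0) := by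
      intro d
      rw [hDval, hT.rot.fst_eq d, ← hfs d, hface]
      split_ifs <;> simp
    rw [Finset.sum_congr rfl fun d _ => h1 d, Finset.sum_add_distrib,
      Equiv.sum_comp σ (fun d => if d.toProd.1 = v then g (Quotient.mk _ d) else 0)]
    exact CharTwo.add_self_eq_zero _
  have hkerD : Module.finrank (ZMod 2) (LinearMap.ker D) ≤ 1 := by
    refine finrank_le_one (⟨fun _ => 1, ?_⟩ : LinearMap.ker D) ?_
    · rw [LinearMap.mem_ker]
      funext ⟨e, he⟩
      induction e with
      | _ u w =>
      have := hDval (fun _ => 1) ⟨(u, w), he⟩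
      rw [CharTwo.add_self_eq_zero] at this
      exact this
    · rintro ⟨g, hg⟩
      rw [LinearMap.mem_ker] at hg
      have hs : ∀ d : G.Dart, g (Quotient.mk _ d.symm) = g (Quotient.mk _ d) := by
        intro d
        have := hDval g d
        rw [hg] at this
        simp only [Pi.zero_apply] at this
        exact (CharTwo.add_eq_zero.1 this.symm).symm
      have hσ : ∀ d : G.Dart, g (Quotient.mk _ (σ d)) = g (Quotient.mk _ d) := by
        intro d
        rw [← hfs d, hface, hs]
      have hσc : ∀ d e : G.Dart, σ.SameCycle d e →
          g (Quotient.mk _ d) = g (Quotient.mk _ e) := by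
        intro d e h
        obtain ⟨n, rfl⟩ := h.exists_nat_pow_eq
        clear h
        induction n with
        | zero => simp
        | succ n ih => rw [pow_succ', Equiv.Perm.mul_apply, hσ, ih]
      have hv : ∀ u w : V, Relation.ReflTransGen G.Adj u w → ∀ d e : G.Dart, d.toProd.1 = u →
          e.toProd.1 = w → g (Quotient.mk _ d) = g (Quotient.mk _ e) := by
        intro u w h
        induction h with
        | refl =>
          intro d e hd he
          exact hσc _ _ (hT.rot.orbit_eq d e (hd.trans he.symm))
        | tail h1 h2 ih =>
          intro d e hd he
          rw [ih d ⟨(_, _), h2⟩ hd rfl, ← hs]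
          exact hσc _ _ (hT.rot.orbit_eq _ _ he.symm)
      have hall : ∀ q q' : Q, g q = g q' := by
        intro q q'
        induction q using Quotient.inductionOn with
        | _ d =>
        induction q' using Quotient.inductionOn with
        | _ e =>
        refine hv d.toProd.1 e.toProd.1 ?_ d e rfl rfl
        rw [← SimpleGraph.reachable_iff_reflTransGen]
        exact hT.connected.preconnected _ _
      by_cases hQ : Nonempty Q
      · obtain ⟨q⟩ := hQ
        refine ⟨g q, ?_⟩
        ext q'
        simp [hall q' q]
      · exact ⟨0, by ext q; exact (hQ ⟨q⟩).elim⟩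
  have hrT : Fintype.card V ≤ Module.finrank (ZMod 2) (LinearMap.range T) + 1 := by
    obtain ⟨v0⟩ := hT.connected.nonempty
    have hedge : ∀ u w, G.Adj u w →
        (Pi.single u 1 + Pi.single w 1 : V → ZMod 2) ∈ LinearMap.range T := by
      intro u w h
      refine ⟨fun e => (Pi.single s(u, w) 1 : Sym2 V → ZMod 2) e.1, ?_⟩
      funext v
      exact bdry_single G h v
    have htop : LinearMap.range T ⊔ Submodule.span (ZMod 2) {(Pi.single v0 1 : V → ZMod 2)} = ⊤ := by
      have hmem : ∀ w, Relation.ReflTransGen G.Adj v0 w → (Pi.single w 1 : V → ZMod 2) ∈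
          LinearMap.range T ⊔ Submodule.span (ZMod 2) {(Pi.single v0 1 : V → ZMod 2)} := by
        intro w h
        induction h with
        | refl => exact Submodule.mem_sup_right (Submodule.mem_span_singleton_self _)
        | tail h1 h2 ih =>
          have := Submodule.add_mem _ (Submodule.mem_sup_left (hedge _ _ h2)) ih
          have h3 : ∀ s t : V → ZMod 2, s + t + s = t := by
            intro s t
            funext i
            simp only [Pi.add_apply]
            rw [add_comm, ← add_assoc, CharTwo.add_self_eq_zero, zero_add]
          rwa [h3] at this
      rw [eq_top_iff, ← (Pi.basisFun (ZMod 2) V).span_eq, Submodule.span_le]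
      rintro _ ⟨w, rfl⟩
      rw [Pi.basisFun_apply]
      refine hmem w ?_
      rw [← SimpleGraph.reachable_iff_reflTransGen]
      exact hT.connected.preconnected _ _
    have h1 := Submodule.finrank_add_le_finrank_add_finrank (LinearMap.range T)
      (Submodule.span (ZMod 2) {(Pi.single v0 1 : V → ZMod 2)})
    rw [htop, finrank_top, Module.finrank_fintype_fun_eq_card] at h1
    have h2 := finrank_span_le_card (R := ZMod 2) ({(Pi.single v0 1 : V → ZMod 2)} : Set _)
    simp only [Set.toFinset_singleton, Finset.card_singleton] at h2
    omega
  have hrnT := LinearMap.finrank_range_add_finrank_ker T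
  have hrnD := LinearMap.finrank_range_add_finrank_ker D
  rw [Module.finrank_fintype_fun_eq_card] at hrnT hrnD
  have heu := hT.euler
  have hnf : numFaces σ = Fintype.card Q := by
    rw [numFaces, Nat.card_eq_fintype_card]
  rw [hnf, Nat.card_eq_fintype_card] at heu
  have heq : LinearMap.range D = LinearMap.ker T := by
    apply Submodule.eq_of_le_of_finrank_le hsub
    change Fintype.card V + Fintype.card Q = Fintype.card E + 2 at heu
    omega
  have hωm : (fun e : E => ω e.1) ∈ LinearMap.ker T := by
    rw [LinearMap.mem_ker]
    funext v
    exact hω v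
  rw [← heq] at hωm
  obtain ⟨g, hg⟩ := hωm
  refine ⟨fun d => g (Quotient.mk _ d), fun d => congrArg g (hface d), fun d => ?_⟩
  rw [← hDval, hg]

theorem face_cube [Fintype V] {G : SimpleGraph V} {σ : Equiv.Perm G.Dart}
    (hT : IsPlaneTriangulation G σ) (d : G.Dart) :
    facePerm σ (facePerm σ (facePerm σ d)) = d := by
  have h := hT.face_size_eq d
  unfold faceSize at h
  set φ := facePerm σ with hφ
  have hper : d ∈ Function.periodicPts φ := by
    have := Function.Injective.mem_periodicPts (f := φ) φ.injective d
    exact this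
  have hmp : Function.minimalPeriod φ d = 3 := by
    rw [← h]
    have e : Nat.card (Fin (Function.minimalPeriod φ d)) = Nat.card {e // φ.SameCycle d e} := by
      refine Nat.card_congr (Equiv.ofBijective
        (fun i => ⟨φ^[i.1] d, ⟨i.1, by rw [zpow_natCast, Equiv.Perm.iterate_eq_pow]⟩⟩) ⟨?_, ?_⟩)
      · intro i j hij
        exact Fin.ext (Function.iterate_injOn_Iio_minimalPeriod i.2 j.2 (congrArg Subtype.val hij))
      · rintro ⟨e, he⟩
        obtain ⟨n, rfl⟩ := he.exists_nat_pow_eq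
        refine ⟨⟨n % Function.minimalPeriod φ d,
          Nat.mod_lt _ (Function.minimalPeriod_pos_of_mem_periodicPts hper)⟩, ?_⟩
        apply Subtype.ext
        change φ^[n % Function.minimalPeriod φ d] d = (φ ^ n) d
        rw [Function.iterate_mod_minimalPeriod_eq, Equiv.Perm.iterate_eq_pow]
    rw [← e, Nat.card_fin]
  have := Function.iterate_minimalPeriod (f := φ) (x := d)
  rw [hmp] at this
  exact this

theorem next_fun {G : SimpleGraph V} {σ : Equiv.Perm G.Dart} {a u w w' : V}
    (h : NextNbr σ a u w) (h' : NextNbr σ a u w') : w = w' := by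
  obtain ⟨h1, rfl⟩ := h
  obtain ⟨h2, rfl⟩ := h'
  rfl

theorem next_iff [Fintype V] {G : SimpleGraph V} {σ : Equiv.Perm G.Dart}
    (hT : IsPlaneTriangulation G σ) {a u w : V} :
    NextNbr σ a u w ↔ ∃ (h : G.Adj a u) (h' : G.Adj a w), σ ⟨(a, u), h⟩ = ⟨(a, w), h'⟩ := by
  constructor
  · rintro ⟨h, rfl⟩
    have h1 := hT.rot.fst_eq ⟨(a, u), h⟩
    simp only at h1
    have h2 : G.Adj a (σ ⟨(a, u), h⟩).toProd.2 := by
      have := (σ ⟨(a, u), h⟩).adj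
      rwa [h1] at this
    refine ⟨h, h2, ?_⟩
    ext
    · exact h1
    · rfl
  · rintro ⟨h, h', e⟩
    exact ⟨h, by rw [e]⟩

theorem next_inj [Fintype V] {G : SimpleGraph V} {σ : Equiv.Perm G.Dart}
    (hT : IsPlaneTriangulation G σ) {a u u' w : V}
    (h : NextNbr σ a u w) (h' : NextNbr σ a u' w) : u = u' := by
  obtain ⟨h1, h2, e⟩ := (next_iff hT).1 h
  obtain ⟨h1', h2', e'⟩ := (next_iff hT).1 h'
  have := σ.injective (e.trans e'.symm)
  simp only [SimpleGraph.Dart.mk.injEq, Prod.mk.injEq] at this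
  exact this.2

theorem next_rot [Fintype V] {G : SimpleGraph V} {σ : Equiv.Perm G.Dart}
    (hT : IsPlaneTriangulation G σ) {a u w : V}
    (h : NextNbr σ a u w) : NextNbr σ u w a := by
  obtain ⟨h1, h2, e⟩ := (next_iff hT).1 h
  have hfs : ∀ {s t : V} (hh : G.Adj s t), facePerm σ ⟨(s, t), hh⟩ = σ ⟨(t, s), hh.symm⟩ := by
    intro s t hh
    rfl
  have hc := face_cube hT ⟨(u, a), h1.symm⟩
  rw [hfs h1.symm, e, hfs h2] at hc
  -- now `σ (w, a)` is `(w, t)`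
  obtain ⟨h3, h4, e'⟩ := (next_iff hT).1 (⟨h2.symm, rfl⟩ :
    NextNbr σ w a (σ ⟨(w, a), h2.symm⟩).toProd.2)
  rw [e'] at hc
  rw [hfs] at hc
  have hu := hT.rot.fst_eq ⟨((σ ⟨(w, a), h2.symm⟩).toProd.2, w), h4.symm⟩
  rw [hc] at hu
  simp only at hu
  have key : ∀ t (ht : G.Adj t w), t = u → σ ⟨(t, w), ht⟩ = ⟨(u, a), h1.symm⟩ →
      NextNbr σ u w a := by
    rintro t ht rfl hh
    exact ⟨ht, by rw [hh]⟩
  exact key _ h4.symm hu.symm hc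

theorem next_adj [Fintype V] {G : SimpleGraph V} {σ : Equiv.Perm G.Dart}
    (hT : IsPlaneTriangulation G σ) {a u w : V}
    (h : NextNbr σ a u w) : G.Adj a u ∧ G.Adj a w ∧ G.Adj u w := by
  obtain ⟨h1, h2, e⟩ := (next_iff hT).1 h
  obtain ⟨h3, h4, e⟩ := (next_iff hT).1 (next_rot hT h)
  exact ⟨h1, h2, h3⟩

/-- Enumeration of the neighbors of a vertex in cyclic order. -/
theorem enum [Fintype V] {G : SimpleGraph V} {σ : Equiv.Perm G.Dart}
    (hT : IsPlaneTriangulation G σ) {a b : V} (hab : G.Adj a b) :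
    ∃ z : ℕ → V, z 0 = b ∧ (∀ i, NextNbr σ a (z i) (z (i + 1))) ∧
      Set.InjOn z (Set.Iio (deg G a)) ∧ (∀ w, G.Adj a w → ∃ i < deg G a, z i = w) ∧
      ∀ i, z (i + deg G a) = z i := by
  let d0 : G.Dart := ⟨(a, b), hab⟩
  have hfst : ∀ i, (σ^[i] d0).toProd.1 = a := by
    intro i
    induction i with
    | zero => rfl
    | succ i ih => rw [Function.iterate_succ_apply', hT.rot.fst_eq, ih]
  have hadj : ∀ i, G.Adj a (σ^[i] d0).toProd.2 := by
    intro i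
    have := (σ^[i] d0).adj
    rwa [hfst] at this
  have hd : ∀ i, σ^[i] d0 = ⟨(a, (σ^[i] d0).toProd.2), hadj i⟩ := by
    intro i
    ext
    · exact hfst i
    · rfl
  have hper : d0 ∈ Function.periodicPts σ :=
    Function.Injective.mem_periodicPts (f := σ) σ.injective d0
  set n := Function.minimalPeriod σ d0 with hn
  have hnpos : 0 < n := Function.minimalPeriod_pos_of_mem_periodicPts hper
  have hinj : Set.InjOn (fun i => (σ^[i] d0).toProd.2) (Set.Iio n) := by
    intro i hi j hj hij
    apply Function.iterate_injOn_Iio_minimalPeriod hi hj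
    change σ^[i] d0 = σ^[j] d0
    ext
    · exact (hfst i).trans (hfst j).symm
    · exact hij
  have hsurj : ∀ w, G.Adj a w → ∃ i < n, (σ^[i] d0).toProd.2 = w := by
    intro w hw
    obtain ⟨m, hm⟩ := (hT.rot.orbit_eq d0 ⟨(a, w), hw⟩ rfl).exists_nat_pow_eq
    refine ⟨m % n, Nat.mod_lt _ hnpos, ?_⟩
    rw [Function.iterate_mod_minimalPeriod_eq, Equiv.Perm.iterate_eq_pow, hm]
  have hdeg : deg G a = n := by
    unfold deg
    rw [← Nat.card_fin n]
    symm
    refine Nat.card_congr (Equiv.ofBijective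
      (fun i => ⟨(σ^[i.1] d0).toProd.2, hadj i.1⟩) ⟨?_, ?_⟩)
    · intro i j hij
      exact Fin.ext (hinj i.2 j.2 (congrArg Subtype.val hij))
    · rintro ⟨w, hw⟩
      obtain ⟨i, hi, rfl⟩ := hsurj w hw
      exact ⟨⟨i, hi⟩, rfl⟩
  rw [hdeg]
  refine ⟨fun i => (σ^[i] d0).toProd.2, rfl, ?_, hinj, hsurj, ?_⟩
  · intro i
    refine ⟨hadj i, ?_⟩
    change _ = (σ^[i + 1] d0).toProd.2
    rw [← hd i, Function.iterate_succ_apply']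
  · intro i
    simp only
    rw [Function.iterate_add_apply, Function.iterate_minimalPeriod]

theorem face_fun' [Fintype V] {G : SimpleGraph V} {σ : Equiv.Perm G.Dart}
    (hT : IsPlaneTriangulation G σ) (ω : Sym2 V → ZMod 2) (hω : ∀ v, bdry G ω v = 0) :
    ∃ f : V → V → ZMod 2, (∀ a u w, NextNbr σ a u w → f a w = f a u + ω s(a, u)) ∧
      (∀ u w, G.Adj u w → f u w + f w u = ω s(u, w)) ∧
      ∀ u, (∀ w, G.Adj u w → ω s(u, w) = 0) →
        ∀ w w', G.Adj u w → G.Adj u w' → f u w = f u w' := by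
  obtain ⟨f, hf1, hf2⟩ := face_fun hT ω hω
  let F : V → V → ZMod 2 := fun u w => if h : G.Adj u w then f ⟨(u, w), h⟩ else 0
  have hF : ∀ u w (h : G.Adj u w), F u w = f ⟨(u, w), h⟩ := by
    intro u w h
    simp [F, h]
  have hA : ∀ a u w, NextNbr σ a u w → F a w = F a u + ω s(a, u) := by
    intro a u w h
    obtain ⟨h1, h2, e⟩ := (next_iff hT).1 h
    rw [hF _ _ h1, hF _ _ h2, ← e]
    have h3 : σ ⟨(a, u), h1⟩ = facePerm σ ⟨(u, a), h1.symm⟩ := rfl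
    have h4 := hf2 ⟨(a, u), h1⟩
    rw [h3, hf1]
    change f ⟨(a, u), h1⟩ + f ⟨(u, a), h1.symm⟩ = ω s(a, u) at h4
    rw [← h4, ← add_assoc, CharTwo.add_self_eq_zero, zero_add]
  refine ⟨F, hA, ?_, ?_⟩
  · intro u w h
    rw [hF _ _ h, hF _ _ h.symm]
    exact hf2 ⟨(u, w), h⟩
  · intro u hu w w' hw hw'
    obtain ⟨z, hz0, hz, -, hs, -⟩ := enum hT hw
    obtain ⟨i, -, rfl⟩ := hs w' hw'
    have : ∀ i, F u (z i) = F u w := by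
      intro i
      induction i with
      | zero => rw [hz0]
      | succ i ih => rw [hA _ _ _ (hz i), hu _ (next_adj hT (hz i)).1, add_zero, ih]
    exact (this i).symm

/-- Connection inside a set of vertices. -/
def Conn (G : SimpleGraph V) (X : Set V) : V → V → Prop :=
  Relation.ReflTransGen (fun s t => G.Adj s t ∧ s ∈ X ∧ t ∈ X)

theorem conn_chain [Fintype V] {G : SimpleGraph V} {X : Set V} {p r : V} (h : Conn G X p r) :
    ∃ ω : Sym2 V → ZMod 2, (∀ u w, ω s(u, w) ≠ 0 → u ∈ X ∧ w ∈ X) ∧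
      ∀ v, bdry G ω v = (Pi.single p 1 : V → ZMod 2) v + (Pi.single r 1 : V → ZMod 2) v := by
  unfold Conn at h
  induction h with
  | refl =>
    refine ⟨0, by simp, fun v => ?_⟩
    rw [CharTwo.add_self_eq_zero]
    simp [bdry]
  | @tail b c h1 h2 ih =>
    obtain ⟨ω, hω1, hω2⟩ := ih
    obtain ⟨hbc, hb, hc⟩ := h2
    refine ⟨ω + Pi.single s(b, c) 1, ?_, ?_⟩
    · intro u w huw
      by_cases h0 : ω s(u, w) = 0
      · simp only [Pi.add_apply, h0, zero_add, Pi.single_apply] at huw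
        have : s(u, w) = s(b, c) := by
          by_contra hne
          simp [hne] at huw
        rw [Sym2.eq_iff] at this
        grind
      · exact hω1 u w h0
    · intro v
      rw [bdry_add, hω2, bdry_single G hbc, add_assoc,
        ← add_assoc ((Pi.single b 1 : V → ZMod 2) v), CharTwo.add_self_eq_zero, zero_add]

/-- Discrete Jordan curve theorem for chains through a vertex. -/
theorem jordan [Fintype V] {G : SimpleGraph V} {σ : Equiv.Perm G.Dart}
    (hT : IsPlaneTriangulation G σ) {X Y : Set V} (hXY : ∀ u ∈ X, u ∉ Y) {a : V}
    (haX : a ∉ X) (haY : a ∉ Y) {z : ℕ → V} {n : ℕ}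
    (hz : ∀ i, NextNbr σ a (z i) (z (i + 1))) (hinj : Set.InjOn z (Set.Iio n))
    {j0 j1 j2 j3 : ℕ} (h01 : j0 < j1) (h12 : j1 < j2) (h23 : j2 < j3) (h3n : j3 < n)
    (h0 : z j0 ∈ X) (h1 : z j1 ∈ Y) (h2 : z j2 ∈ X)
    (hX : Conn G X (z j0) (z j2)) (hY : Conn G Y (z j1) (z j3)) : False := by
  obtain ⟨ω0, hω1, hω2⟩ := conn_chain hX
  have ha : ∀ i, G.Adj a (z i) := fun i => (next_adj hT (hz i)).1
  have hzz : ∀ i j, i < n → j < n → z i = z j → i = j := fun i j hi hj h => hinj hi hj h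
  set ω := ω0 + (Pi.single s(a, z j0) 1 + Pi.single s(a, z j2) 1) with hω
  have hb : ∀ v, bdry G ω v = 0 := by
    intro v
    rw [hω, bdry_add, bdry_add, hω2, bdry_single G (ha j0), bdry_single G (ha j2)]
    have : ∀ s t u : ZMod 2, s + t + (u + s + (u + t)) = 0 := by decide
    exact this _ _ _
  obtain ⟨f, hf1, hf2, hf3⟩ := face_fun' hT ω hb
  have hωY : ∀ u w, u ∈ Y → w ∈ Y ∨ True → G.Adj u w → ω s(u, w) = 0 := by
    intro u w hu _ _
    have e0 : ω0 s(u, w) = 0 := by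
      by_contra hne
      exact hXY u (hω1 u w hne).1 hu
    have e1 : ∀ t ∈ X, s(u, w) ≠ s(a, t) := by
      intro t ht h
      rw [Sym2.eq_iff] at h
      rcases h with ⟨rfl, -⟩ | ⟨rfl, -⟩
      · exact haY hu
      · exact hXY _ ht hu
    simp [hω, e0, e1 _ h0, e1 _ h2]
  have hYc : ∀ u w, Conn G Y u w → u ∈ Y → w ∈ Y ∧ ∀ t t', G.Adj u t → G.Adj w t' →
      f u t = f w t' := by
    intro u w h hu
    unfold Conn at h
    induction h with
    | refl =>
      exact ⟨hu, fun t t' ht ht' => hf3 u (fun w hw => hωY u w hu (Or.inr trivial) hw) t t' ht ht'⟩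
    | @tail b c h1 h2 ih =>
      obtain ⟨hbc, hb, hc⟩ := h2
      refine ⟨hc, fun t t' ht ht' => ?_⟩
      rw [ih.2 t c ht hbc,
        hf3 c (fun w hw => hωY c w hc (Or.inr trivial) hw) t' b ht' hbc.symm]
      have := hf2 b c hbc
      rw [hωY b c hb (Or.inr trivial) hbc] at this
      exact CharTwo.add_eq_zero.1 this
  have hωa : ∀ i, i < n → ω s(a, z i) = if i = j0 ∨ i = j2 then 1 else 0 := by
    intro i hi
    have e0 : ω0 s(a, z i) = 0 := by
      by_contra hne
      exact haX (hω1 _ _ hne).1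
    have e1 : ∀ j, j < n → (s(a, z i) = s(a, z j) ↔ i = j) := by
      intro j hj
      constructor
      · intro h
        rw [Sym2.eq_iff] at h
        rcases h with ⟨-, h⟩ | ⟨h, h'⟩
        · exact hzz _ _ hi hj h
        · exact absurd h (ha j).ne
      · rintro rfl
        rfl
    simp only [hω, Pi.add_apply, e0, Pi.single_apply, e1 j0 (by omega), e1 j2 (by omega)]
    by_cases h : i = j0
    · have : i ≠ j2 := by omega
      simp [h, show j0 ≠ j2 by omega]
    · by_cases h' : i = j2
      · simp [h', show j2 ≠ j0 by omega]
      · simp [h, h']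
  have step : ∀ i, i < n → f a (z (i + 1)) = f a (z i) + if i = j0 ∨ i = j2 then 1 else 0 := by
    intro i hi
    rw [hf1 _ _ _ (hz i), hωa i hi]
  have s1 : ∀ k, j0 + 1 + k ≤ j2 → f a (z (j0 + 1 + k)) = f a (z j0) + 1 := by
    intro k
    induction k with
    | zero =>
      intro _
      rw [Nat.add_zero, step j0 (by omega), if_pos (Or.inl rfl)]
    | succ k ih =>
      intro hk
      rw [show j0 + 1 + (k + 1) = (j0 + 1 + k) + 1 by omega, step _ (by omega),
        if_neg (by omega), add_zero]
      exact ih (by omega)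
  have s2 : ∀ k, j2 + 1 + k < n → f a (z (j2 + 1 + k)) = f a (z j0) := by
    intro k
    induction k with
    | zero =>
      intro _
      rw [Nat.add_zero, step j2 (by omega), if_pos (Or.inr rfl)]
      have := s1 (j2 - j0 - 1) (by omega)
      rw [show j0 + 1 + (j2 - j0 - 1) = j2 by omega] at this
      rw [this, add_assoc, CharTwo.add_self_eq_zero, add_zero]
    | succ k ih =>
      intro hk
      rw [show j2 + 1 + (k + 1) = (j2 + 1 + k) + 1 by omega, step _ (by omega),
        if_neg (by omega), add_zero]
      exact ih (by omega)
  have t1 := s1 (j1 - j0 - 1) (by omega)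
  rw [show j0 + 1 + (j1 - j0 - 1) = j1 by omega] at t1
  have t3 := s2 (j3 - j2 - 1) (by omega)
  rw [show j2 + 1 + (j3 - j2 - 1) = j3 by omega] at t3
  obtain ⟨-, h13⟩ := hYc _ _ hY h1
  have h13' := h13 a a (ha j1).symm (ha j3).symm
  have e1 := hf2 a (z j1) (ha j1)
  have e3 := hf2 a (z j3) (ha j3)
  rw [hωa j1 (by omega), if_neg (by omega)] at e1
  rw [hωa j3 (by omega), if_neg (by omega)] at e3
  have e1' := CharTwo.add_eq_zero.1 e1
  have e3' := CharTwo.add_eq_zero.1 e3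
  rw [← e1', ← e3', t1, t3] at h13'
  simp at h13'

/-- The map `c` is a proper coloring of the vertices in `U`. -/
def Good (G : SimpleGraph V) (U : Set V) (c : V → Fin 5) : Prop :=
  ∀ u ∈ U, ∀ w ∈ U, G.Adj u w → c u ≠ c w

theorem kempe_swap {G : SimpleGraph V} {U : Set V} {c : V → Fin 5} {k A C : Fin 5} {a p : V}
    (hg : Good G U c) (ha : a ∉ U) (hAC : A ≠ C) (hAk : A ≠ k) (hCk : C ≠ k)
    {X : Set V} (hX : X = {u | u ∈ U ∧ (c u = A ∨ c u = C)}) (hp : p ∈ X)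
    (hA : ∀ u ∈ U, G.Adj a u → c u = A → Conn G X p u)
    (hC : ∀ u ∈ U, G.Adj a u → c u = C → ¬ Conn G X p u) :
    ∃ c' : V → Fin 5, Good G (insert a U) c' ∧ c' a ≠ k ∧ ∀ u ∈ U, (c' u = k ↔ c u = k) := by
  have hK : ∀ u, Conn G X p u → u ∈ X := by
    intro u h
    unfold Conn at h
    cases h with
    | refl => exact hp
    | tail _ h2 => exact h2.2.2
  have hK' : ∀ u, Conn G X p u → u ∈ U ∧ (c u = A ∨ c u = C) := by
    intro u h
    have := hK u h
    rw [hX] at this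
    exact this
  have hstep : ∀ u w, Conn G X p u → w ∈ U → G.Adj u w → (c w = A ∨ c w = C) →
      Conn G X p w := by
    intro u w h hw huw hc
    refine Relation.ReflTransGen.tail h ⟨huw, hK u h, ?_⟩
    rw [hX]
    exact ⟨hw, hc⟩
  let c' : V → Fin 5 := fun u => if u = a then A else
    if Conn G X p u then (if c u = A then C else A) else c u
  have hc'a : c' a = A := by simp [c']
  have hc' : ∀ u ∈ U, c' u = if Conn G X p u then (if c u = A then C else A) else c u := by
    intro u hu
    have : u ≠ a := by
      rintro rfl
      exact ha hu
    simp [c', this]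
  have hna : ∀ u ∈ U, G.Adj a u → c' u ≠ A := by
    intro u hu hau
    rw [hc' u hu]
    have h1 := hA u hu hau
    have h2 := hC u hu hau
    have h3 := hK' u
    split_ifs <;> grind
  refine ⟨c', ?_, by rw [hc'a]; exact hAk, ?_⟩
  · intro u hu w hw huw
    rcases hu with rfl | hu
    · rcases hw with rfl | hw
      · exact absurd rfl huw.ne
      · rw [hc'a]
        exact (hna w hw huw).symm
    · rcases hw with rfl | hw
      · rw [hc'a]
        exact hna u hu huw.symm
      · rw [hc' u hu, hc' w hw]
        have h0 := hg u hu w hw huw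
        have h1 := hstep u w
        have h2 := hstep w u
        have h3 := hK' u
        have h4 := hK' w
        have h5 := huw.symm
        split_ifs <;> grind
  · intro u hu
    rw [hc' u hu]
    have h3 := hK' u
    split_ifs <;> grind

theorem kempe [Fintype V] {G : SimpleGraph V} {σ : Equiv.Perm G.Dart}
    (hT : IsPlaneTriangulation G σ) {U : Set V} {c : V → Fin 5} {k : Fin 5} {a : V}
    (hg : Good G U c) (ha : a ∉ U) (h4 : {u | G.Adj a u ∧ u ∈ U ∧ c u ≠ k}.ncard ≤ 4) :
    ∃ c' : V → Fin 5, Good G (insert a U) c' ∧ c' a ≠ k ∧ ∀ u ∈ U, (c' u = k ↔ c u = k) := by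
  by_cases hfree : ∃ γ, γ ≠ k ∧ ∀ u ∈ U, G.Adj a u → c u ≠ γ
  · obtain ⟨γ, hγk, hγ⟩ := hfree
    have hne : ∀ u ∈ U, u ≠ a := by
      rintro u hu rfl
      exact ha hu
    refine ⟨Function.update c a γ, ?_, by simpa using hγk, ?_⟩
    · intro u hu w hw huw
      rcases hu with rfl | hu
      · rcases hw with rfl | hw
        · exact absurd rfl huw.ne
        · rw [Function.update_self, Function.update_of_ne (hne w hw)]
          exact (hγ w hw huw).symm
      · rcases hw with rfl | hw
        · rw [Function.update_self, Function.update_of_ne (hne u hu)]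
          exact hγ u hu huw.symm
        · rw [Function.update_of_ne (hne u hu), Function.update_of_ne (hne w hw)]
          exact hg u hu w hw huw
    · intro u hu
      rw [Function.update_of_ne (hne u hu)]
  push Not at hfree
  obtain ⟨b, hab⟩ : ∃ b, G.Adj a b := by
    obtain ⟨γ, hγ⟩ := exists_ne k
    obtain ⟨u, -, hu, -⟩ := hfree γ hγ
    exact ⟨u, hu⟩
  obtain ⟨z, -, hz, hinj, hs, -⟩ := enum hT hab
  have haz : ∀ i, G.Adj a (z i) := fun i => (next_adj hT (hz i)).1
  set n := deg G a with hn
  let I : Finset ℕ := (Finset.range n).filter fun i => z i ∈ U ∧ c (z i) ≠ k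
  have hI4 : I.card ≤ 4 := by
    refine le_trans ?_ h4
    rw [← Set.ncard_coe_finset]
    refine Set.ncard_le_ncard_of_injOn z ?_ ?_ (Set.toFinite _)
    · intro i hi
      simp only [I, Finset.coe_filter, Finset.mem_range, Set.mem_ofPred_eq] at hi
      exact ⟨haz i, hi.2⟩
    · intro i hi j hj hij
      simp only [I, Finset.coe_filter, Finset.mem_range, Set.mem_ofPred_eq] at hi hj
      exact hinj hi.1 hj.1 hij
  have himg : Finset.univ.erase k ⊆ I.image (fun i => c (z i)) := by
    intro γ hγ
    rw [Finset.mem_erase] at hγ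
    obtain ⟨u, hu, hau, hcu⟩ := hfree γ hγ.1
    obtain ⟨i, hi, rfl⟩ := hs u hau
    rw [Finset.mem_image]
    refine ⟨i, ?_, hcu⟩
    simp only [I, Finset.mem_filter, Finset.mem_range]
    exact ⟨hi, hu, by rw [hcu]; exact hγ.1⟩
  have hc4 : (Finset.univ.erase k : Finset (Fin 5)).card = 4 := by
    rw [Finset.card_erase_of_mem (Finset.mem_univ k)]
    simp
  have hi1 := Finset.card_le_card himg
  have hi2 : (I.image (fun i => c (z i))).card ≤ I.card := Finset.card_image_le
  have hIc : I.card = 4 := by omega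
  have hcinj : Set.InjOn (fun i => c (z i)) I := by
    rw [← Finset.card_image_iff]
    omega
  let e := I.orderEmbOfFin hIc
  have heI : ∀ i, e i < n ∧ z (e i) ∈ U ∧ c (z (e i)) ≠ k := by
    intro i
    have := I.orderEmbOfFin_mem hIc i
    simp only [I, Finset.mem_filter, Finset.mem_range] at this
    exact this
  have hmem : ∀ i, e i ∈ I := fun i => I.orderEmbOfFin_mem hIc i
  have hcol : ∀ i j, c (z (e i)) = c (z (e j)) → i = j := by
    intro i j h
    exact e.injective (hcinj (hmem i) (hmem j) h)
  have huniq : ∀ u ∈ U, G.Adj a u → ∀ i, c u = c (z (e i)) → u = z (e i) := by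
    intro u hu hau i hci
    obtain ⟨j, hj, rfl⟩ := hs u hau
    have hjI : j ∈ I := by
      simp only [I, Finset.mem_filter, Finset.mem_range]
      exact ⟨hj, hu, by rw [hci]; exact (heI i).2.2⟩
    rw [hcinj hjI (hmem i) hci]
  have hsw : ∀ i j, i ≠ j →
      (¬ Conn G {u | u ∈ U ∧ (c u = c (z (e i)) ∨ c u = c (z (e j)))} (z (e i)) (z (e j))) →
      ∃ c' : V → Fin 5, Good G (insert a U) c' ∧ c' a ≠ k ∧ ∀ u ∈ U, (c' u = k ↔ c u = k) := by
    intro i j hij hcon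
    refine kempe_swap (A := c (z (e i))) (C := c (z (e j))) hg ha (fun h => hij (hcol _ _ h))
      (heI i).2.2 (heI j).2.2 rfl (p := z (e i)) ⟨(heI i).2.1, Or.inl rfl⟩ ?_ ?_
    · intro u hu hau hc
      rw [huniq u hu hau i hc]
      exact Relation.ReflTransGen.refl
    · intro u hu hau hc
      rw [huniq u hu hau j hc]
      exact hcon
  by_cases h02 : Conn G {u | u ∈ U ∧ (c u = c (z (e 0)) ∨ c u = c (z (e 2)))} (z (e 0)) (z (e 2))
  · by_cases h13 : Conn G {u | u ∈ U ∧ (c u = c (z (e 1)) ∨ c u = c (z (e 3)))}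
        (z (e 1)) (z (e 3))
    · exfalso
      refine jordan hT (n := n)
        (X := {u | u ∈ U ∧ (c u = c (z (e 0)) ∨ c u = c (z (e 2)))})
        (Y := {u | u ∈ U ∧ (c u = c (z (e 1)) ∨ c u = c (z (e 3)))}) ?_ (fun h => ha h.1) (fun h => ha h.1) hz hinj
        (j0 := e 0) (j1 := e 1) (j2 := e 2) (j3 := e 3) ?_ ?_ ?_ (heI 3).1
        ⟨(heI 0).2.1, Or.inl rfl⟩ ⟨(heI 1).2.1, Or.inl rfl⟩ ⟨(heI 2).2.1, Or.inr rfl⟩ h02 h13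
      · rintro u ⟨-, hu⟩ ⟨-, hu'⟩
        have n01 : ¬ c (z (e 0)) = c (z (e 1)) := fun h => absurd (hcol _ _ h) (by decide)
        have n03 : ¬ c (z (e 0)) = c (z (e 3)) := fun h => absurd (hcol _ _ h) (by decide)
        have n21 : ¬ c (z (e 2)) = c (z (e 1)) := fun h => absurd (hcol _ _ h) (by decide)
        have n23 : ¬ c (z (e 2)) = c (z (e 3)) := fun h => absurd (hcol _ _ h) (by decide)
        grind
      · exact e.strictMono (by decide)
      · exact e.strictMono (by decide)
      · exact e.strictMono (by decide)
    · exact hsw 1 3 (by decide) h13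
  · exact hsw 0 2 (by decide) h02

theorem start [Fintype V] {G : SimpleGraph V} {σ : Equiv.Perm G.Dart}
    (hG : IsMinimalCounterexample G σ) {S : Set V} (hS : S.Nonempty) :
    ∃ (c : V → Fin 5) (k : Fin 5), Good G Sᶜ c ∧
      6 * {u | u ∈ Sᶜ ∧ c u = k}.ncard + S.ncard ≤ Fintype.card V := by
  have hcard : Fintype.card (Sᶜ : Set V) + S.ncard = Fintype.card V := by
    rw [← Nat.card_eq_fintype_card, ← Nat.card_eq_fintype_card, Nat.card_coe_set_eq, add_comm]
    exact Set.ncard_add_ncard_compl S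
  have hpos : 0 < S.ncard := (Set.ncard_pos (Set.toFinite S)).2 hS
  obtain ⟨c, hc, k, hk⟩ := hG.2.2 (Sᶜ : Set V) (G.induce Sᶜ)
    ⟨V, inferInstance, G, σ, hG.1, ⟨fun u => u.1, fun h => h⟩, Subtype.val_injective⟩ (by omega)
  refine ⟨fun u => if h : u ∈ Sᶜ then c ⟨u, h⟩ else 0, k, ?_, ?_⟩
  · intro u hu w hw huw
    simp only [hu, hw, dite_true]
    exact hc (show (G.induce Sᶜ).Adj ⟨u, hu⟩ ⟨w, hw⟩ from huw)
  · have : {u | u ∈ Sᶜ ∧ (if h : u ∈ Sᶜ then c ⟨u, h⟩ else 0) = k} =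
        Subtype.val '' {w : (Sᶜ : Set V) | c w = k} := by
      ext u
      constructor
      · rintro ⟨hu, h⟩
        simp only [hu, dite_true] at h
        exact ⟨⟨u, hu⟩, h, rfl⟩
      · rintro ⟨⟨u, hu⟩, h, rfl⟩
        refine ⟨hu, ?_⟩
        simp only [hu, dite_true]
        exact h
    rw [this, Set.ncard_image_of_injective _ Subtype.val_injective]
    rw [Nat.card_coe_set_eq] at hk
    omega

theorem no_col [Fintype V] {G : SimpleGraph V} {σ : Equiv.Perm G.Dart}
    (hG : IsMinimalCounterexample G σ) {c : V → Fin 5} (k : Fin 5) (hc : Good G Set.univ c)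
    (hk : 6 * {u | c u = k}.ncard ≤ Fintype.card V) : False := by
  refine hG.2.1 ⟨c, fun u w h => hc u (Set.mem_univ _) w (Set.mem_univ _) h, k, ?_⟩
  rw [Nat.card_coe_set_eq]
  exact hk

theorem perm_exists (k b w t b' w' α : Fin 5) (hbw : b ≠ w) (htb : t ≠ b) (htw : t ≠ w)
    (hb : b' = k ↔ b = k) (hw : w' = k ↔ w = k) (hbw' : b' ≠ w') (hα : α ≠ k) :
    ∃ π : Equiv.Perm (Fin 5), π k = k ∧ π b = b' ∧ π w = w' ∧ π t ≠ α := by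
  obtain ⟨t', ht'α, ht'b, ht'w, ht'k⟩ : ∃ t', t' ≠ α ∧ t' ≠ b' ∧ t' ≠ w' ∧ (t' = k ↔ t = k) := by
    by_cases htk : t = k
    · subst htk
      exact ⟨t, hα.symm, fun h => htb (hb.1 h.symm).symm, fun h => htw (hw.1 h.symm).symm, by simp⟩
    · have : ∃ t', t' ∉ ({α, b', w', k} : Finset (Fin 5)) := by
        by_contra h
        push Not at h
        have h1 : (Finset.univ : Finset (Fin 5)) ⊆ {α, b', w', k} := fun i _ => h i
        have h2 := Finset.card_le_card h1
        have h3 := Finset.card_le_four (a := α) (b := b') (c := w') (d := k)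
        simp at h2
        omega
      obtain ⟨t', h⟩ := this
      simp only [Finset.mem_insert, Finset.mem_singleton, not_or] at h
      exact ⟨t', h.1, h.2.1, h.2.2.1, by simp [h.2.2.2, htk]⟩
  let f : Fin 5 → Fin 5 := fun i => if i = k then k else if i = b then b' else
    if i = w then w' else t'
  have hinj : Set.InjOn f ({k, b, w, t} : Finset (Fin 5)) := by
    intro i hi j hj hij
    simp only [Finset.coe_insert, Finset.coe_singleton, Set.mem_insert_iff,
      Set.mem_singleton_iff] at hi hj
    simp only [f] at hij
    grind
  obtain ⟨g, hg⟩ := Finset.exists_equiv_extend_of_card_eq (α := Fin 5) (t := Finset.univ)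
    (by simp) (Finset.subset_univ _) hinj
  refine ⟨g.trans (Equiv.subtypeUnivEquiv (by simp)), ?_, ?_, ?_, ?_⟩
  · have := hg k (by simp)
    simp only [Equiv.trans_apply, Equiv.subtypeUnivEquiv_apply, this, f]
    simp
  · have := hg b (by simp)
    simp only [Equiv.trans_apply, Equiv.subtypeUnivEquiv_apply, this, f]
    grind
  · have := hg w (by simp)
    simp only [Equiv.trans_apply, Equiv.subtypeUnivEquiv_apply, this, f]
    grind
  · have := hg t (by simp)
    simp only [Equiv.trans_apply, Equiv.subtypeUnivEquiv_apply, this, f]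
    grind

theorem no_sep [Fintype V] {G : SimpleGraph V} {σ : Equiv.Perm G.Dart}
    (hG : IsMinimalCounterexample G σ) {a b t w : V} (hdeg : deg G a = 5)
    (h1 : NextNbr σ a b t) (h2 : NextNbr σ a t w) (hbw : G.Adj b w) : False := by
  have hT := hG.1
  have hab := (next_adj hT h1).1
  have hat := (next_adj hT h2).1
  have haw := (next_adj hT h2).2.1
  obtain ⟨z, hz0, hz, hinj, hs, hzp⟩ := enum hT hab
  rw [hdeg] at hinj hs hzp
  have haz : ∀ i, G.Adj a (z i) := fun i => (next_adj hT (hz i)).1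
  have hz1 : z 1 = t := by
    have := hz 0
    rw [hz0] at this
    exact next_fun this h1
  have hz2 : z 2 = w := by
    have := hz 1
    rw [hz1] at this
    exact next_fun this h2
  have hne : ∀ i j, i < 5 → j < 5 → i ≠ j → z i ≠ z j :=
    fun i j hi hj hij h => hij (hinj hi hj h)
  -- the triangle
  set ω : Sym2 V → ZMod 2 := Pi.single s(a, b) 1 + (Pi.single s(b, w) 1 + Pi.single s(a, w) 1)
    with hω
  have hb : ∀ v, bdry G ω v = 0 := by
    intro v
    rw [hω, bdry_add, bdry_add, bdry_single G hab, bdry_single G hbw, bdry_single G haw]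
    have : ∀ s t u : ZMod 2, s + t + (t + u + (s + u)) = 0 := by decide
    exact this _ _ _
  obtain ⟨f, hf1, hf2, hf3⟩ := face_fun' hT ω hb
  have hω0 : ∀ y y', y ≠ a → y ≠ b → y ≠ w → ω s(y, y') = 0 := by
    intro y y' ha hb hw
    have e1 : s(y, y') ≠ s(a, b) := by
      intro h
      rw [Sym2.eq_iff] at h
      grind
    have e2 : s(y, y') ≠ s(b, w) := by
      intro h
      rw [Sym2.eq_iff] at h
      grind
    have e3 : s(y, y') ≠ s(a, w) := by
      intro h
      rw [Sym2.eq_iff] at h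
      grind
    simp [hω, e1, e2, e3]
  have hna : a ≠ b := hab.ne
  have hnw : a ≠ w := haw.ne
  have hnb : b ≠ w := hbw.ne
  have hωb : ω s(a, b) = 1 := by
    have e2 : s(a, b) ≠ s(b, w) := by
      intro h
      rw [Sym2.eq_iff] at h
      grind
    have e3 : s(a, b) ≠ s(a, w) := by
      intro h
      rw [Sym2.eq_iff] at h
      grind
    simp [hω, e2, e3]
  have hωw : ω s(a, w) = 1 := by
    have e2 : s(a, w) ≠ s(b, w) := by
      intro h
      rw [Sym2.eq_iff] at h
      grind
    have e3 : s(a, w) ≠ s(a, b) := by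
      intro h
      rw [Sym2.eq_iff] at h
      grind
    simp [hω, e2, e3]
  have hout : ∀ i, i < 5 → i ≠ 0 → i ≠ 2 → z i ≠ a ∧ z i ≠ b ∧ z i ≠ w := by
    intro i hi h0 h2
    refine ⟨(haz i).ne', ?_, ?_⟩
    · rw [← hz0]
      exact hne _ _ hi (by omega) h0
    · rw [← hz2]
      exact hne _ _ hi (by omega) h2
  have hωi : ∀ i, i < 5 → i ≠ 0 → i ≠ 2 → ω s(a, z i) = 0 := by
    intro i hi h0 h2
    obtain ⟨q1, q2, q3⟩ := hout i hi h0 h2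
    rw [Sym2.eq_swap]
    exact hω0 _ _ q1 q2 q3
  have f1 : f a (z 1) = f a b + 1 := by
    have := hf1 _ _ _ (hz 0)
    rw [hz0, hωb] at this
    exact this
  have f2 : f a (z 2) = f a b + 1 := by
    have := hf1 _ _ _ (hz 1)
    rw [hωi 1 (by omega) (by omega) (by omega), f1, add_zero] at this
    exact this
  have f3 : f a (z 3) = f a b := by
    have := hf1 _ _ _ (hz 2)
    rw [f2, hz2, hωw, add_assoc, CharTwo.add_self_eq_zero, add_zero] at this
    exact this
  have f4 : f a (z 4) = f a b := by
    have := hf1 _ _ _ (hz 3)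
    rw [hωi 3 (by omega) (by omega) (by omega), f3, add_zero] at this
    exact this
  let I : Set V := {y | y ≠ a ∧ y ≠ b ∧ y ≠ w ∧ ∀ y', G.Adj y y' → f y y' = f a b + 1}
  have hIstep : ∀ y y', y ∈ I → G.Adj y y' → y' = a ∨ y' = b ∨ y' = w ∨ y' ∈ I := by
    rintro y y' ⟨ya, yb, yw, hy⟩ hyy
    by_contra hcon
    push Not at hcon
    obtain ⟨ya', yb', yw', hI'⟩ := hcon
    apply hI'
    refine ⟨ya', yb', yw', fun y'' h => ?_⟩
    rw [hf3 y' (fun w _ => hω0 _ _ ya' yb' yw') y'' y h hyy.symm]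
    have := hf2 y y' hyy
    rw [hω0 _ _ ya yb yw] at this
    rw [← CharTwo.add_eq_zero.1 this]
    exact hy y' hyy
  have hfz : ∀ i, i < 5 → i ≠ 0 → i ≠ 2 → f (z i) a = f a (z i) := by
    intro i hi h0 h2
    have := hf2 a (z i) (haz i)
    rw [hωi i hi h0 h2] at this
    exact (CharTwo.add_eq_zero.1 this).symm
  have ht : t ∈ I := by
    rw [← hz1]
    obtain ⟨q1, q2, q3⟩ := hout 1 (by omega) (by omega) (by omega)
    refine ⟨q1, q2, q3, fun y' h => ?_⟩
    rw [hf3 _ (fun w _ => hω0 _ _ q1 q2 q3) y' a h (haz 1).symm, hfz 1 (by omega) (by omega)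
      (by omega), f1]
  have hIa : ∀ y ∈ I, G.Adj a y → y = t := by
    rintro y ⟨ya, yb, yw, hy⟩ hay
    obtain ⟨i, hi, rfl⟩ := hs y hay
    have h5 := hy a hay.symm
    interval_cases i
    · exact absurd hz0 yb
    · exact hz1
    · exact absurd hz2 yw
    · rw [hfz 3 (by omega) (by omega) (by omega), f3] at h5
      simp at h5
    · rw [hfz 4 (by omega) (by omega) (by omega), f4] at h5
      simp at h5
  have haI : a ∉ I := fun h => h.1 rfl
  have hbI : b ∉ I := fun h => h.2.1 rfl
  have hwI : w ∉ I := fun h => h.2.2.1 rfl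
  -- coloring
  obtain ⟨c, k, hc, hk⟩ := start hG (S := {a}) ⟨a, rfl⟩
  have hc' : ∀ u u', u ≠ a → u' ≠ a → G.Adj u u' → c u ≠ c u' := fun u u' h h' hh =>
    hc u h u' h' hh
  let U : Set V := {y | y ≠ a ∧ y ∉ I}
  have hU : Good G U c := fun u hu u' hu' h => hc' u u' hu.1 hu'.1 h
  obtain ⟨c₂, hg2, hk2, hcc⟩ := kempe hT (k := k) hU (a := a) (fun h => h.1 rfl) (by
    have hsub : {u | G.Adj a u ∧ u ∈ U ∧ c u ≠ k} ⊆ ((Finset.image z {0, 2, 3, 4} : Finset V) :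
        Set V) := by
      rintro u ⟨hau, hu, -⟩
      obtain ⟨i, hi, rfl⟩ := hs u hau
      have : i ≠ 1 := by
        rintro rfl
        rw [hz1] at hu
        exact hu.2 ht
      rw [Finset.mem_coe, Finset.mem_image]
      refine ⟨i, ?_, rfl⟩
      simp only [Finset.mem_insert, Finset.mem_singleton]
      omega
    refine le_trans (Set.ncard_le_ncard hsub (Set.toFinite _)) ?_
    rw [Set.ncard_coe_finset]
    exact le_trans Finset.card_image_le (by decide))
  have hbU : b ∈ U := ⟨hna.symm, hbI⟩
  have hwU : w ∈ U := ⟨hnw.symm, hwI⟩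
  obtain ⟨π, hπk, hπb, hπw, hπt⟩ := perm_exists k (c b) (c w) (c t) (c₂ b) (c₂ w) (c₂ a)
    (hc' _ _ hna.symm hnw.symm hbw)
    (hc' _ _ hat.ne' hna.symm (next_adj hT h1).2.2.symm)
    (hc' _ _ hat.ne' hnw.symm (next_adj hT h2).2.2)
    (hcc b hbU) (hcc w hwU)
    (hg2 _ (Set.mem_insert_of_mem _ hbU) _ (Set.mem_insert_of_mem _ hwU) hbw) hk2
  have hIadj : ∀ y y', y ∈ I → y' ∉ I → G.Adj y y' → π (c y) ≠ c₂ y' := by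
    intro y y' hy hy' hyy
    rcases hIstep y y' hy hyy with rfl | rfl | rfl | h
    · rw [hIa y hy hyy.symm]
      exact hπt
    · rw [← hπb]
      exact fun h => hc' y y' hy.1 hna.symm hyy (π.injective h)
    · rw [← hπw]
      exact fun h => hc' y y' hy.1 hnw.symm hyy (π.injective h)
    · exact absurd h hy'
  have hins : ∀ y, y ∉ I → y ∈ insert a U := by
    intro y hy
    by_cases h : y = a
    · exact Or.inl h
    · exact Or.inr ⟨h, hy⟩
  refine no_col hG (c := fun y => if y ∈ I then π (c y) else c₂ y) k ?_ ?_
  · intro u _ u' _ huu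
    by_cases hu : u ∈ I <;> by_cases hu' : u' ∈ I
    · simp only [hu, hu', if_true]
      exact fun h => hc' u u' hu.1 hu'.1 huu (π.injective h)
    · simp only [hu, hu', if_true, if_false]
      exact hIadj u u' hu hu' huu
    · simp only [hu, hu', if_true, if_false]
      exact (hIadj u' u hu' hu huu.symm).symm
    · simp only [hu, hu', if_false]
      exact hg2 u (hins u hu) u' (hins u' hu') huu
  · have heq : {u | (if u ∈ I then π (c u) else c₂ u) = k} ⊆ {u | u ∈ ({a} : Set V)ᶜ ∧ c u = k} := by
      intro u hu
      change (if u ∈ I then π (c u) else c₂ u) = k at hu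
      by_cases hI : u ∈ I
      · rw [if_pos hI] at hu
        refine ⟨hI.1, ?_⟩
        apply π.injective
        rw [hu, hπk]
      · rw [if_neg hI] at hu
        have hua : u ≠ a := by
          rintro rfl
          exact hk2 hu
        exact ⟨hua, (hcc u ⟨hua, hI⟩).1 hu⟩
    have := Set.ncard_le_ncard heq (Set.toFinite _)
    omega

/-- At a vertex of degree 5, adjacent neighbors are consecutive. -/
theorem five_consec [Fintype V] {G : SimpleGraph V} {σ : Equiv.Perm G.Dart}
    (hG : IsMinimalCounterexample G σ) {a b w : V} (hdeg : deg G a = 5)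
    (hab : G.Adj a b) (haw : G.Adj a w) (hbw : G.Adj b w) :
    NextNbr σ a b w ∨ NextNbr σ a w b := by
  obtain ⟨z, hz0, hz, hinj, hs, hzp⟩ := enum hG.1 hab
  rw [hdeg] at hinj hs hzp
  have hz5 : z 5 = z 0 := hzp 0
  obtain ⟨i, hi, rfl⟩ := hs w haw
  rw [← hz0]
  rw [← hz0] at hbw
  interval_cases i
  · exact absurd rfl hbw.ne
  · exact Or.inl (hz 0)
  · exact (no_sep hG hdeg (hz 0) (hz 1) hbw).elim
  · have h4 := hz 4
    rw [show 4 + 1 = 5 by rfl, hz5] at h4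
    exact (no_sep hG hdeg (hz 3) h4 hbw.symm).elim
  · have h4 := hz 4
    rw [show 4 + 1 = 5 by rfl, hz5] at h4
    exact Or.inr h4

/-- There is a proper coloring of `U` whose class `k` is `K`. -/
def St (G : SimpleGraph V) (k : Fin 5) (U K : Set V) : Prop :=
  ∃ c : V → Fin 5, Good G U c ∧ ∀ u ∈ U, (c u = k ↔ u ∈ K)

theorem st_kempe [Fintype V] {G : SimpleGraph V} {σ : Equiv.Perm G.Dart}
    (hT : IsPlaneTriangulation G σ) {U K : Set V} {k : Fin 5} {a : V}
    (hst : St G k U K) (ha : a ∉ U) (hK : K ⊆ U) (E : Finset V)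
    (hE : ∀ e ∈ E, G.Adj a e ∧ (e ∉ U ∨ e ∈ K)) (hd : deg G a ≤ 4 + E.card) :
    St G k (insert a U) K := by
  obtain ⟨c, hg, hc⟩ := hst
  obtain ⟨c', hg', hk', hcc⟩ := kempe hT (k := k) hg ha (by
    have hsub : {u | G.Adj a u ∧ u ∈ U ∧ c u ≠ k} ⊆ G.neighborSet a \ (E : Set V) := by
      rintro u ⟨h1, h2, h3⟩
      refine ⟨h1, fun h => ?_⟩
      rcases (hE u h).2 with h4 | h4
      · exact h4 h2
      · exact h3 ((hc u h2).2 h4)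
    have h1 := Set.ncard_le_ncard hsub (Set.toFinite _)
    have hEs : (E : Set V) ⊆ G.neighborSet a := fun e he => (hE e he).1
    rw [Set.ncard_sdiff hEs (Set.toFinite _), Set.ncard_coe_finset] at h1
    unfold deg at hd
    rw [Nat.card_coe_set_eq] at hd
    omega)
  refine ⟨c', hg', ?_⟩
  rintro u (rfl | hu)
  · exact ⟨fun h => absurd h hk', fun h => absurd (hK h) ha⟩
  · rw [hcc u hu, hc u hu]

theorem st_joker {G : SimpleGraph V} {U K : Set V} {k : Fin 5} {a : V}
    (hst : St G k U K) (ha : a ∉ U) (hn : ∀ u ∈ U, G.Adj a u → u ∉ K) :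
    St G k (insert a U) (insert a K) := by
  obtain ⟨c, hg, hc⟩ := hst
  have hne : ∀ u ∈ U, u ≠ a := by
    rintro u hu rfl
    exact ha hu
  refine ⟨Function.update c a k, ?_, ?_⟩
  · intro u hu w hw huw
    rcases hu with rfl | hu
    · rcases hw with rfl | hw
      · exact absurd rfl huw.ne
      · rw [Function.update_self, Function.update_of_ne (hne w hw)]
        exact fun h => hn w hw huw ((hc w hw).1 h.symm)
    · rcases hw with rfl | hw
      · rw [Function.update_self, Function.update_of_ne (hne u hu)]
        exact fun h => hn u hu huw.symm ((hc u hu).1 h)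
      · rw [Function.update_of_ne (hne u hu), Function.update_of_ne (hne w hw)]
        exact hg u hu w hw huw
  · rintro u (rfl | hu)
    · simp
    · rw [Function.update_of_ne (hne u hu), hc u hu, Set.mem_insert_iff]
      simp [hne u hu]

theorem st_five [Fintype V] {G : SimpleGraph V} {σ : Equiv.Perm G.Dart}
    (hT : IsPlaneTriangulation G σ) {U K : Set V} {k : Fin 5} {a : V}
    (hst : St G k U K) (ha : a ∉ U) (hK : K ⊆ U) (hd : deg G a = 5)
    (hw : ∃ w, G.Adj a w ∧ (w ∉ U ∨ w ∈ K)) : St G k (insert a U) K := by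
  obtain ⟨w, hw⟩ := hw
  refine st_kempe hT hst ha hK {w} ?_ (by simp [hd])
  intro e he
  rw [Finset.mem_singleton] at he
  rw [he]
  exact hw

theorem st_all [Fintype V] {G : SimpleGraph V} {σ : Equiv.Perm G.Dart}
    (hT : IsPlaneTriangulation G σ) {K : Set V} {k : Fin 5} {x : V} (hx : x ∈ K) (A : Finset V) :
    ∀ U : Set V, St G k U K → K ⊆ U → (∀ a ∈ A, a ∉ U ∧ deg G a = 5 ∧ G.Adj a x) →
      St G k (U ∪ A) K := by
  induction A using Finset.induction_on with
  | empty =>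
    intro U h _ _
    simpa using h
  | insert b A hb ih =>
    intro U h hK hA
    have h1 := hA b (Finset.mem_insert_self _ _)
    have h2 := st_five hT h h1.1 hK h1.2.1 ⟨x, h1.2.2, Or.inr hx⟩
    have h3 := ih (insert b U) h2 (fun u hu => Or.inr (hK hu)) (by
      intro a ha
      have h4 := hA a (Finset.mem_insert_of_mem ha)
      refine ⟨?_, h4.2⟩
      rintro (rfl | h5)
      · exact hb ha
      · exact h4.1 h5)
    have : U ∪ ((insert b A : Finset V) : Set V) = insert b U ∪ (A : Set V) := by
      ext u
      simp only [Finset.coe_insert, Set.mem_union, Set.mem_insert_iff]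
      tauto
    rw [this]
    exact h3

/-- Adjacency of an index to an element of a list in the cyclic order. -/
def AdjC (i : Fin 7) (L : List (Fin 7)) : Prop := ∃ j ∈ L, j = i + 1 ∨ i = j + 1

instance (i : Fin 7) (L : List (Fin 7)) : Decidable (AdjC i L) := by
  unfold AdjC
  infer_instance

theorem order_three [Fintype V] {G : SimpleGraph V} {σ : Equiv.Perm G.Dart}
    (hT : IsPlaneTriangulation G σ) {y : Fin 7 → V} (hy : Function.Injective y)
    (hyy : ∀ i, G.Adj (y i) (y (i + 1))) {F : Finset (Fin 7)} (hF5 : ∀ i ∈ F, deg G (y i) = 5)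
    {K U : Set V} {k : Fin 5} (hU : ∀ u, u ∈ U ↔ ∀ i ∈ F, u ≠ y i) (hK : K ⊆ U)
    (hst : St G k U K) {m : Fin 7} (hm : y m ∈ K) {i1 i2 i3 i4 : Fin 7}
    (h : F = {i1, i2, i3, i4} ∧ [i1, i2, i3, i4].Nodup ∧ AdjC i1 [m, i2, i3, i4] ∧
      AdjC i2 [m, i3, i4] ∧ AdjC i3 [m, i4]) :
    St G k (insert (y i3) (insert (y i2) (insert (y i1) U))) K ∧
      y i4 ∉ (insert (y i3) (insert (y i2) (insert (y i1) U))) ∧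
      insert (y i4) (insert (y i3) (insert (y i2) (insert (y i1) U))) = Set.univ := by
  obtain ⟨hF, hnd, h1, h2, h3⟩ := h
  have hadj : ∀ i j, (j = i + 1 ∨ i = j + 1) → G.Adj (y i) (y j) := by
    rintro i j (rfl | rfl)
    · exact hyy i
    · exact (hyy j).symm
  have hnU : ∀ i ∈ F, y i ∉ U := fun i hi h => (hU _).1 h i hi rfl
  have m1 : i1 ∈ F := by simp [hF]
  have m2 : i2 ∈ F := by simp [hF]
  have m3 : i3 ∈ F := by simp [hF]
  have m4 : i4 ∈ F := by simp [hF]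
  simp only [List.nodup_cons, List.mem_cons, List.not_mem_nil, or_false, not_or, not_false_eq_true,
    List.nodup_nil, and_true] at hnd
  obtain ⟨⟨n12, n13, n14⟩, ⟨n23, n24⟩, n34⟩ := hnd
  have hne : ∀ {i j}, i ≠ j → y i ≠ y j := fun h h' => h (hy h')
  have s1 : St G k (insert (y i1) U) K := by
    obtain ⟨j, hj, hj'⟩ := h1
    refine st_five hT hst (hnU i1 m1) hK (hF5 i1 m1) ⟨y j, hadj _ _ hj', ?_⟩
    simp only [List.mem_cons, List.not_mem_nil, or_false] at hj
    rcases hj with rfl | rfl | rfl | rfl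
    · exact Or.inr hm
    · exact Or.inl (hnU _ m2)
    · exact Or.inl (hnU _ m3)
    · exact Or.inl (hnU _ m4)
  have nU1 : ∀ i ∈ F, i ≠ i1 → y i ∉ insert (y i1) U := by
    rintro i hi hn (h | h)
    · exact hn (hy h)
    · exact hnU i hi h
  have K1 : K ⊆ insert (y i1) U := fun u hu => Or.inr (hK hu)
  have s2 : St G k (insert (y i2) (insert (y i1) U)) K := by
    obtain ⟨j, hj, hj'⟩ := h2
    refine st_five hT s1 (nU1 i2 m2 (Ne.symm n12)) K1 (hF5 i2 m2) ⟨y j, hadj _ _ hj', ?_⟩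
    simp only [List.mem_cons, List.not_mem_nil, or_false] at hj
    rcases hj with rfl | rfl | rfl
    · exact Or.inr hm
    · exact Or.inl (nU1 _ m3 (Ne.symm n13))
    · exact Or.inl (nU1 _ m4 (Ne.symm n14))
  have nU2 : ∀ i ∈ F, i ≠ i1 → i ≠ i2 → y i ∉ insert (y i2) (insert (y i1) U) := by
    rintro i hi hn hn' (h | h)
    · exact hn' (hy h)
    · exact nU1 i hi hn h
  have K2 : K ⊆ insert (y i2) (insert (y i1) U) := fun u hu => Or.inr (K1 hu)
  have s3 : St G k (insert (y i3) (insert (y i2) (insert (y i1) U))) K := by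
    obtain ⟨j, hj, hj'⟩ := h3
    refine st_five hT s2 (nU2 i3 m3 (Ne.symm n13) (Ne.symm n23)) K2 (hF5 i3 m3)
      ⟨y j, hadj _ _ hj', ?_⟩
    simp only [List.mem_cons, List.not_mem_nil, or_false] at hj
    rcases hj with rfl | rfl
    · exact Or.inr hm
    · exact Or.inl (nU2 _ m4 (Ne.symm n14) (Ne.symm n24))
  refine ⟨s3, ?_, ?_⟩
  · rintro (h | h)
    · exact n34 (hy h).symm
    · exact nU2 _ m4 (Ne.symm n14) (Ne.symm n24) h
  · rw [Set.eq_univ_iff_forall]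
    intro u
    by_cases hu : u ∈ U
    · exact Or.inr (Or.inr (Or.inr (Or.inr hu)))
    · rw [hU] at hu
      push Not at hu
      obtain ⟨i, hi, rfl⟩ := hu
      rw [hF] at hi
      simp only [Finset.mem_insert, Finset.mem_singleton] at hi
      rcases hi with rfl | rfl | rfl | rfl <;> simp

theorem order_joker [Fintype V] {G : SimpleGraph V} {σ : Equiv.Perm G.Dart}
    (hT : IsPlaneTriangulation G σ) {y : Fin 7 → V} (hy : Function.Injective y)
    (hyy : ∀ i, G.Adj (y i) (y (i + 1))) {F : Finset (Fin 7)} (hF5 : ∀ i ∈ F, deg G (y i) = 5)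
    {K U : Set V} {k : Fin 5} (hU : ∀ u, u ∈ U ↔ ∀ i ∈ F, u ≠ y i) (hK : K ⊆ U)
    (hst : St G k U K) {m : Fin 7} (hm : y m ∈ K) (i1 i2 i3 i4 : Fin 7)
    (h : F = {i1, i2, i3, i4} ∧ [i1, i2, i3, i4].Nodup ∧ AdjC i1 [m, i2, i3, i4] ∧
      AdjC i2 [m, i3, i4] ∧ AdjC i3 [m, i4]) :
    ∃ K' g, St G k Set.univ K' ∧ K' ⊆ insert g K := by
  obtain ⟨s3, hn, hu⟩ := order_three hT hy hyy hF5 hU hK hst hm h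
  by_cases hs : ∃ w, G.Adj (y i4) w ∧ w ∈ K
  · obtain ⟨w, hw, hwK⟩ := hs
    have := st_five hT s3 hn (fun u hu => Or.inr (Or.inr (Or.inr (hK hu))))
      (hF5 i4 (by simp [h.1])) ⟨w, hw, Or.inr hwK⟩
    rw [hu] at this
    exact ⟨K, y i4, this, Set.subset_insert _ _⟩
  · push Not at hs
    have := st_joker s3 hn (fun u _ hu => hs u hu)
    rw [hu] at this
    exact ⟨_, y i4, this, subset_rfl⟩

theorem order_all [Fintype V] {G : SimpleGraph V} {σ : Equiv.Perm G.Dart}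
    (hT : IsPlaneTriangulation G σ) {y : Fin 7 → V} (hy : Function.Injective y)
    (hyy : ∀ i, G.Adj (y i) (y (i + 1))) {F : Finset (Fin 7)} (hF5 : ∀ i ∈ F, deg G (y i) = 5)
    {K U : Set V} {k : Fin 5} (hU : ∀ u, u ∈ U ↔ ∀ i ∈ F, u ≠ y i) (hK : K ⊆ U)
    (hst : St G k U K) {m : Fin 7} (hm : y m ∈ K) (i1 i2 i3 i4 : Fin 7)
    (h : F = {i1, i2, i3, i4} ∧ [i1, i2, i3, i4].Nodup ∧ AdjC i1 [m, i2, i3, i4] ∧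
      AdjC i2 [m, i3, i4] ∧ AdjC i3 [m, i4]) (h4 : AdjC i4 [m]) :
    St G k Set.univ K := by
  obtain ⟨s3, hn, hu⟩ := order_three hT hy hyy hF5 hU hK hst hm h
  obtain ⟨j, hj, hj'⟩ := h4
  rw [List.mem_singleton] at hj
  subst hj
  have hadj : G.Adj (y i4) (y j) := by
    rcases hj' with rfl | rfl
    · exact hyy i4
    · exact (hyy j).symm
  have := st_five hT s3 hn (fun u hu => Or.inr (Or.inr (Or.inr (hK hu))))
      (hF5 i4 (by simp [h.1])) ⟨_, hadj, Or.inr hm⟩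
  rwa [hu] at this

theorem core [Fintype V] {G : SimpleGraph V} {σ : Equiv.Perm G.Dart}
    (hG : IsMinimalCounterexample G σ) {x e : V} (hdx : deg G x = 7) {y : Fin 7 → V}
    (hy : Function.Injective y) (hN : ∀ w, G.Adj x w ↔ ∃ i, y i = w)
    {F : Finset (Fin 7)} (hF4 : F.card = 4)
    (hF5 : ∀ i ∈ F, deg G (y i) = 5) (hex : e ≠ x) (heF : ∀ i ∈ F, e ≠ y i)
    (hE : ∃ E : Finset V, (∀ t ∈ E, G.Adj e t ∧ (t = x ∨ ∃ i ∈ F, t = y i)) ∧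
      deg G e ≤ 4 + E.card)
    (hB : ∀ (k : Fin 5) (U K : Set V), (∀ u, u ∈ U ↔ u ≠ e ∧ ∀ i ∈ F, u ≠ y i) →
      K ⊆ U → x ∉ K → St G k U K → (∃ m, m ∉ F ∧ y m ∈ K) →
      ∃ K' g, St G k Set.univ K' ∧ K' ⊆ insert g K) : False := by
  have hT := hG.1
  have hxy : ∀ i, x ≠ y i := fun i => ((hN (y i)).2 ⟨i, rfl⟩).ne
  let A : Finset V := F.image y
  have hA : A.card = 4 := by rw [Finset.card_image_of_injective _ hy, hF4]
  have hmA : ∀ u, u ∈ A ↔ ∃ i ∈ F, y i = u := fun u => Finset.mem_image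
  have heA : e ∉ A := by
    rw [hmA]
    rintro ⟨i, hi, h⟩
    exact heF i hi h.symm
  have hxA : x ∉ A := by
    rw [hmA]
    rintro ⟨i, hi, h⟩
    exact hxy i h.symm
  let S : Finset V := insert x (insert e A)
  have hS : S.card = 6 := by
    rw [Finset.card_insert_of_notMem, Finset.card_insert_of_notMem heA, hA]
    rw [Finset.mem_insert, not_or]
    exact ⟨hex.symm, hxA⟩
  obtain ⟨c, k, hg, hk⟩ := start hG (S := (S : Set V)) ⟨x, by simp [S]⟩
  rw [Set.ncard_coe_finset, hS] at hk
  let U : Set V := (S : Set V)ᶜ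
  let K : Set V := {u | u ∈ U ∧ c u = k}
  change 6 * K.ncard + 6 ≤ _ at hk
  have hKU : K ⊆ U := fun u hu => hu.1
  have hst : St G k U K := ⟨c, hg, fun u hu => ⟨fun h => ⟨hu, h⟩, fun h => h.2⟩⟩
  have hU : ∀ u, u ∈ U ↔ u ≠ x ∧ u ≠ e ∧ u ∉ A := by
    intro u
    simp only [U, S, Set.mem_compl_iff, Finset.mem_coe, Finset.mem_insert, not_or]
  have hxU : x ∉ U := by simp [hU]
  have hfin : ∃ K' g, St G k Set.univ K' ∧ K' ⊆ insert g K := by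
    by_cases hs : ∃ w, G.Adj x w ∧ w ∈ K
    · obtain ⟨w, hw, hwK⟩ := hs
      obtain ⟨m, rfl⟩ := (hN w).1 hw
      have hmF : m ∉ F := fun h => ((hU _).1 (hKU hwK)).2.2 ((hmA _).2 ⟨m, h, rfl⟩)
      have h1 : St G k (insert x U) K := by
        refine st_kempe hT hst hxU hKU A ?_ (by omega)
        intro t ht
        refine ⟨?_, Or.inl fun h => ((hU _).1 h).2.2 ht⟩
        obtain ⟨i, -, rfl⟩ := (hmA t).1 ht
        exact (hN _).2 ⟨i, rfl⟩
      refine hB k (insert x U) K ?_ (fun u hu => Or.inr (hKU hu)) (fun h => hxU (hKU h)) h1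
        ⟨m, hmF, hwK⟩
      intro u
      rw [Set.mem_insert_iff, hU, hmA]
      constructor
      · rintro (rfl | ⟨h1, h2, h3⟩)
        · exact ⟨hex.symm, fun i _ => hxy i⟩
        · exact ⟨h2, fun i hi h => h3 ⟨i, hi, h.symm⟩⟩
      · rintro ⟨h1, h2⟩
        by_cases hux : u = x
        · exact Or.inl hux
        · refine Or.inr ⟨hux, h1, ?_⟩
          rintro ⟨i, hi, h⟩
          exact h2 i hi h.symm
    · push Not at hs
      have h1 := st_joker hst hxU (fun u _ hu => hs u hu)
      have hK1 : insert x K ⊆ insert x U := Set.insert_subset_insert hKU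
      obtain ⟨E, hE1, hE2⟩ := hE
      have h2 : St G k (insert e (insert x U)) (insert x K) := by
        refine st_kempe hT h1 ?_ hK1 E ?_ hE2
        · rintro (h | h)
          · exact hex h
          · exact ((hU e).1 h).2.1 rfl
        · intro t ht
          obtain ⟨h3, h4⟩ := hE1 t ht
          refine ⟨h3, ?_⟩
          rcases h4 with rfl | ⟨i, hi, rfl⟩
          · exact Or.inr (Or.inl rfl)
          · refine Or.inl ?_
            rintro (h | h)
            · exact hxy i h.symm
            · exact ((hU _).1 h).2.2 ((hmA _).2 ⟨i, hi, rfl⟩)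
      have h3 := st_all hT (x := x) (Or.inl rfl) A _ h2 (fun u hu => Or.inr (hK1 hu)) (by
        intro a ha
        refine ⟨?_, ?_⟩
        · rintro (rfl | rfl | h)
          · exact heA ha
          · exact hxA ha
          · exact ((hU _).1 h).2.2 ha
        · obtain ⟨i, hi, rfl⟩ := (hmA a).1 ha
          exact ⟨hF5 i hi, ((hN _).2 ⟨i, rfl⟩).symm⟩)
      have : insert e (insert x U) ∪ (A : Set V) = Set.univ := by
        rw [Set.eq_univ_iff_forall]
        intro u
        by_cases h1 : u = x
        · exact Or.inl (Or.inr (Or.inl h1))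
        by_cases h2 : u = e
        · exact Or.inl (Or.inl h2)
        by_cases h3 : u ∈ A
        · exact Or.inr h3
        · exact Or.inl (Or.inr (Or.inr ((hU u).2 ⟨h1, h2, h3⟩)))
      rw [this] at h3
      exact ⟨_, x, h3, subset_rfl⟩
  obtain ⟨K', g, ⟨c', hg', hc'⟩, hsub⟩ := hfin
  refine no_col hG k hg' ?_
  have e1 : {u | c' u = k} = K' := by
    ext u
    exact hc' u (Set.mem_univ u)
  rw [e1]
  have h1 := Set.ncard_le_ncard hsub (Set.toFinite _)
  have h2 := Set.ncard_insert_le g K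
  omega

theorem six_cases : ∀ F : Finset (Fin 7), F.card = 4 → 0 ∉ F → 1 ∈ F → 6 ∈ F →
    (F = {1, 2, 3, 6} ∨ F = {1, 2, 4, 6} ∨ F = {1, 2, 5, 6}) ∨
    (F = {1, 3, 4, 6} ∨ F = {1, 3, 5, 6} ∨ F = {1, 4, 5, 6}) := by
  set_option maxRecDepth 10000 in decide

theorem main_red [Fintype V] {G : SimpleGraph V} {σ : Equiv.Perm G.Dart}
    (hG : IsMinimalCounterexample G σ) {x p : V} (hdx : deg G x = 7) {y : Fin 7 → V}
    (hy : Function.Injective y) (hN : ∀ w, G.Adj x w ↔ ∃ i, y i = w)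
    (hyy : ∀ i, G.Adj (y i) (y (i + 1)))
    {F : Finset (Fin 7)} (hF4 : F.card = 4)
    (hF5 : ∀ i, i ∈ F ↔ deg G (y i) = 5) (h0 : (0 : Fin 7) ∉ F) (h1 : (1 : Fin 7) ∈ F)
    (h6 : (6 : Fin 7) ∈ F) (hpx : p ≠ x) (hxp : ¬ G.Adj x p) (hp1 : G.Adj p (y 1))
    (hp2 : G.Adj p (y 2)) :
    ∃ t, G.Adj (y 1) t ∧ t ≠ y 0 ∧ t ≠ x ∧ 7 ≤ deg G t := by
  by_contra hcon
  push Not at hcon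
  have hT := hG.1
  have hxy : ∀ i, G.Adj x (y i) := fun i => (hN (y i)).2 ⟨i, rfl⟩
  have hne : ∀ {i j}, i ≠ j → y i ≠ y j := fun h h' => h (hy h')
  have hd2 : deg G (y 2) < 7 := hcon (y 2) (hyy 1) (hne (by decide)) (hxy 2).ne'
  have hpy : ∀ i, p ≠ y i := fun i h => hxp (h ▸ hxy i)
  have hdp : deg G p < 7 := hcon p hp1.symm (hpy 0) hpx
  have hF5' : ∀ i ∈ F, deg G (y i) = 5 := fun i hi => (hF5 i).1 hi
  have hU1 : ∀ (e : V) (U : Set V), (∀ i ∈ F, e ≠ y i) →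
      (∀ u, u ∈ U ↔ u ≠ e ∧ ∀ i ∈ F, u ≠ y i) →
      ∀ u, u ∈ insert e U ↔ ∀ i ∈ F, u ≠ y i := by
    intro e U he hU u
    rw [Set.mem_insert_iff, hU]
    constructor
    · rintro (rfl | h)
      · exact he
      · exact h.2
    · intro h
      by_cases hu : u = e
      · exact Or.inl hu
      · exact Or.inr ⟨hu, h⟩
  rcases six_cases F hF4 h0 h1 h6 with hc | hc
  · -- the case where the second vertex has degree five
    have h2 : (2 : Fin 7) ∈ F := by rcases hc with h | h | h <;> rw [h] <;> decide
    have hcard : ({y 1, y 2} : Finset V).card = 2 := Finset.card_pair (hne (by decide))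
    have hEm : ∀ t ∈ ({y 1, y 2} : Finset V), G.Adj p t ∧ ∃ i ∈ F, t = y i := by
      intro t ht
      rw [Finset.mem_insert, Finset.mem_singleton] at ht
      rcases ht with rfl | rfl
      · exact ⟨hp1, 1, h1, rfl⟩
      · exact ⟨hp2, 2, h2, rfl⟩
    refine core hG hdx hy hN hF4 hF5' hpx (fun i _ => hpy i)
      ⟨{y 1, y 2}, fun t ht => ⟨(hEm t ht).1, Or.inr (hEm t ht).2⟩, by omega⟩ ?_
    intro k U K hU hKU hxK hst ⟨m, hmF, hm⟩
    have hpU : p ∉ U := fun h => ((hU p).1 h).1 rfl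
    have hst1 : St G k (insert p U) K := by
      refine st_kempe hT hst hpU hKU {y 1, y 2} ?_ (by omega)
      intro t ht
      refine ⟨(hEm t ht).1, Or.inl fun h => ?_⟩
      obtain ⟨i, hi, h'⟩ := (hEm t ht).2
      exact ((hU t).1 h).2 i hi h'
    have hU' := hU1 p U (fun i _ => hpy i) hU
    have hK' : K ⊆ insert p U := fun u hu => Or.inr (hKU hu)
    rcases hc with rfl | rfl | rfl
    · have hm3 : m = 0 ∨ m = 4 ∨ m = 5 := by clear hm; revert hmF; revert m; decide
      rcases hm3 with rfl | rfl | rfl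
      · exact order_joker hT hy hyy hF5' hU' hK' hst1 hm 3 2 1 6 (by decide)
      · exact order_joker hT hy hyy hF5' hU' hK' hst1 hm 1 2 3 6 (by decide)
      · exact order_joker hT hy hyy hF5' hU' hK' hst1 hm 6 1 2 3 (by decide)
    · have hm3 : m = 0 ∨ m = 3 ∨ m = 5 := by clear hm; revert hmF; revert m; decide
      rcases hm3 with rfl | rfl | rfl
      · exact order_joker hT hy hyy hF5' hU' hK' hst1 hm 2 1 6 4 (by decide)
      · exact order_joker hT hy hyy hF5' hU' hK' hst1 hm 1 2 4 6 (by decide)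
      · exact order_joker hT hy hyy hF5' hU' hK' hst1 hm 4 6 1 2 (by decide)
    · have hm3 : m = 0 ∨ m = 3 ∨ m = 4 := by clear hm; revert hmF; revert m; decide
      rcases hm3 with rfl | rfl | rfl
      · exact order_joker hT hy hyy hF5' hU' hK' hst1 hm 2 1 5 6 (by decide)
      · exact order_joker hT hy hyy hF5' hU' hK' hst1 hm 1 2 5 6 (by decide)
      · exact order_joker hT hy hyy hF5' hU' hK' hst1 hm 6 5 1 2 (by decide)
  · have h2 : (2 : Fin 7) ∉ F := by rcases hc with h | h | h <;> rw [h] <;> decide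
    have heF : ∀ i ∈ F, y 2 ≠ y i := fun i hi h => h2 (hy h ▸ hi)
    have hcard : ({x, y 1} : Finset V).card = 2 := Finset.card_pair (hxy 1).ne
    refine core hG hdx hy hN hF4 hF5' (hxy 2).ne' heF ⟨{x, y 1}, ?_, by omega⟩ ?_
    · intro t ht
      rw [Finset.mem_insert, Finset.mem_singleton] at ht
      rcases ht with rfl | rfl
      · exact ⟨(hxy 2).symm, Or.inl rfl⟩
      · exact ⟨(hyy 1).symm, Or.inr ⟨1, h1, rfl⟩⟩
    intro k U K hU hKU hxK hst ⟨m, hmF, hm⟩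
    have hpU : y 2 ∉ U := fun h => ((hU _).1 h).1 rfl
    have hm2 : m ≠ 2 := by
      rintro rfl
      exact hpU (hKU hm)
    have hU' := hU1 (y 2) U heF hU
    have hK' : K ⊆ insert (y 2) U := fun u hu => Or.inr (hKU hu)
    have h1U : y 1 ∉ U := fun h => ((hU _).1 h).2 1 h1 rfl
    have hst3 : (3 : Fin 7) ∈ F → St G k (insert (y 2) U) K := by
      intro h3
      have hcard : ({y 1, y 3} : Finset V).card = 2 := Finset.card_pair (hne (by decide))
      refine st_kempe hT hst hpU hKU {y 1, y 3} ?_ (by omega)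
      intro t ht
      rw [Finset.mem_insert, Finset.mem_singleton] at ht
      rcases ht with rfl | rfl
      · exact ⟨(hyy 1).symm, Or.inl h1U⟩
      · exact ⟨hyy 2, Or.inl fun h => ((hU _).1 h).2 3 h3 rfl⟩
    rcases hc with rfl | rfl | rfl
    · have hm3 : m = 0 ∨ m = 5 := by clear hm; revert hm2 hmF; revert m; decide
      have hst1 := hst3 (by decide)
      rcases hm3 with rfl | rfl
      · exact order_joker hT hy hyy hF5' hU' hK' hst1 hm 1 6 3 4 (by decide)
      · exact order_joker hT hy hyy hF5' hU' hK' hst1 hm 6 3 4 1 (by decide)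
    · have hm3 : m = 0 ∨ m = 4 := by clear hm; revert hm2 hmF; revert m; decide
      have hst1 := hst3 (by decide)
      rcases hm3 with rfl | rfl
      · exact order_joker hT hy hyy hF5' hU' hK' hst1 hm 1 5 6 3 (by decide)
      · exact order_joker hT hy hyy hF5' hU' hK' hst1 hm 3 6 5 1 (by decide)
    · have hm3 : m = 0 ∨ m = 3 := by clear hm; revert hm2 hmF; revert m; decide
      by_cases hs : ∃ w, G.Adj (y 2) w ∧ w ∈ K
      · obtain ⟨w, hw, hwK⟩ := hs
        have hst1 : St G k (insert (y 2) U) K := by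
          have hcard : ({y 1, w} : Finset V).card = 2 :=
            Finset.card_pair (fun h => h1U (h ▸ hKU hwK))
          refine st_kempe hT hst hpU hKU {y 1, w} ?_ (by omega)
          intro t ht
          rw [Finset.mem_insert, Finset.mem_singleton] at ht
          rcases ht with rfl | rfl
          · exact ⟨(hyy 1).symm, Or.inl h1U⟩
          · exact ⟨hw, Or.inr hwK⟩
        rcases hm3 with rfl | rfl
        · exact order_joker hT hy hyy hF5' hU' hK' hst1 hm 4 5 6 1 (by decide)
        · exact order_joker hT hy hyy hF5' hU' hK' hst1 hm 6 5 4 1 (by decide)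
      · push Not at hs
        have hst1 := st_joker hst hpU (fun u _ hu => hs u hu)
        rcases hm3 with rfl | rfl
        · exact ⟨_, y 2, order_all hT hy hyy hF5' hU' (Set.insert_subset_insert hKU) hst1
            (Or.inr hm) 4 5 6 1 (by decide) (by decide), subset_rfl⟩
        · exact absurd hm (hs _ (hyy 2))

theorem ex_p [Fintype V] {G : SimpleGraph V} {σ : Equiv.Perm G.Dart}
    (hG : IsMinimalCounterexample G σ) {x a b : V} (hd : deg G a = 5) (hxa : G.Adj x a)
    (hab : G.Adj a b) (hxb : G.Adj x b) :
    ∃ p, p ≠ x ∧ ¬ G.Adj x p ∧ G.Adj p a ∧ G.Adj p b := by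
  have hT := hG.1
  obtain ⟨z, hz0, hz, hinj, -, hper⟩ := enum hT hab
  rw [hd] at hinj hper
  have hne : ∀ {i j : ℕ}, i < 5 → j < 5 → i ≠ j → z i ≠ z j :=
    fun hi hj h h' => h (hinj hi hj h')
  have h5 : z 5 = z 0 := hper 0
  have h45 : NextNbr σ a (z 4) (z 0) := h5 ▸ hz 4
  have hb4 : G.Adj (z 4) (z 0) := (next_adj hT h45).2.2
  have hb1 : G.Adj (z 0) (z 1) := (next_adj hT (hz 0)).2.2
  have ha : ∀ i, G.Adj a (z i) := fun i => (next_adj hT (hz i)).1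
  have key : ¬ G.Adj (z 1) (z 4) := by
    intro h
    rcases five_consec hG hd (ha 1) (ha 4) h with h | h
    · exact hne (by norm_num) (by norm_num) (by norm_num) (next_fun (hz 1) h)
    · exact hne (by norm_num) (by norm_num) (by norm_num) (next_fun h45 h)
  subst hz0
  rcases five_consec hG hd hab hxa.symm hxb.symm with h | h
  · have hx : z 1 = x := next_fun (hz 0) h
    subst hx
    exact ⟨z 4, hne (by norm_num) (by norm_num) (by norm_num), key, (ha 4).symm, hb4⟩
  · have hx : z 4 = x := next_inj hT h45 h
    subst hx
    exact ⟨z 1, hne (by norm_num) (by norm_num) (by norm_num), fun h => key h.symm,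
      (ha 1).symm, hb1.symm⟩

theorem side [Fintype V] {G : SimpleGraph V} {σ : Equiv.Perm G.Dart}
    (hG : IsMinimalCounterexample G σ) {x : V} (hdx : deg G x = 7) {y : Fin 7 → V}
    (hv : 9 ≤ deg G (y 0))
    (hy : Function.Injective y) (hN : ∀ w, G.Adj x w ↔ ∃ i, y i = w)
    (hyy : ∀ i, G.Adj (y i) (y (i + 1)))
    (h4 : Nat.card {u : V | G.Adj x u ∧ deg G u = 5} = 4)
    (h1 : deg G (y 1) = 5) (h6 : deg G (y 6) = 5) :
    3 ≤ Nat.card {w : V | G.Adj (y 1) w ∧ 7 ≤ deg G w} := by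
  have hxy : ∀ i, G.Adj x (y i) := fun i => (hN (y i)).2 ⟨i, rfl⟩
  let F : Finset (Fin 7) := Finset.univ.filter (fun i => deg G (y i) = 5)
  have hF5 : ∀ i, i ∈ F ↔ deg G (y i) = 5 := fun i => by simp [F]
  have hF4 : F.card = 4 := by
    have : {u : V | G.Adj x u ∧ deg G u = 5} = ((F.image y : Finset V) : Set V) := by
      ext u
      simp only [Set.mem_setOf_eq, Finset.coe_image, Set.mem_image, Finset.mem_coe, hF5]
      constructor
      · rintro ⟨h, h'⟩
        obtain ⟨i, rfl⟩ := (hN u).1 h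
        exact ⟨i, h', rfl⟩
      · rintro ⟨i, h, rfl⟩
        exact ⟨hxy i, h⟩
    rw [this, Nat.card_coe_set_eq, Set.ncard_coe_finset, Finset.card_image_of_injective _ hy] at h4
    exact h4
  obtain ⟨p, hpx, hxp, hp1, hp2⟩ := ex_p hG h1 (hxy 1) (hyy 1) (hxy _)
  obtain ⟨t, ht1, ht0, htx, ht7⟩ := main_red hG hdx hy hN hyy hF4 hF5
    (by rw [hF5]; omega) ((hF5 1).2 h1) ((hF5 6).2 h6) hpx hxp hp1 hp2
  rw [Nat.card_coe_set_eq]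
  have hs : (({y 0, x, t} : Finset V) : Set V) ⊆ {w : V | G.Adj (y 1) w ∧ 7 ≤ deg G w} := by
    intro w hw
    simp only [Finset.coe_insert, Finset.coe_singleton, Set.mem_insert_iff,
      Set.mem_singleton_iff] at hw
    rcases hw with rfl | rfl | rfl
    · exact ⟨(hyy 0).symm, by omega⟩
    · exact ⟨(hxy 1).symm, hdx.ge⟩
    · exact ⟨ht1, ht7⟩
  have := Set.ncard_le_ncard hs (Set.toFinite _)
  rw [Set.ncard_coe_finset, Finset.card_eq_three.2
    ⟨y 0, x, t, (hxy 0).ne', ht0.symm, htx.symm, rfl⟩] at this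
  exact this

end helpers

theorem statement15 [Fintype V] (G : SimpleGraph V) (σ : Equiv.Perm G.Dart)
    (hG : IsMinimalCounterexample G σ) (v x : V)
    (hv : 9 ≤ deg G v) (hvx : G.Adj v x) (hdx : deg G x = 7)
    (h4 : Nat.card {u : V | G.Adj x u ∧ deg G u = 5} = 4)
    (hnopath : ¬ ∃ a b c d : V, ({a, b, c, d} : Set V) = {u : V | G.Adj x u ∧ deg G u = 5} ∧
        List.Nodup [a, b, c, d] ∧ G.Adj a b ∧ G.Adj b c ∧ G.Adj c d)
    (hvtwo : ∃ a b : V, a ≠ b ∧ (G.Adj x a ∧ deg G a = 5) ∧ (G.Adj x b ∧ deg G b = 5) ∧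
        G.Adj v a ∧ G.Adj v b) :
    (∀ y : V, NextNbr σ v x y →
      deg G y = 5 ∧ 3 ≤ Nat.card {w : V | G.Adj y w ∧ 7 ≤ deg G w}) ∧
    (∀ y : V, NextNbr σ v y x →
      deg G y = 5 ∧ 3 ≤ Nat.card {w : V | G.Adj y w ∧ 7 ≤ deg G w}) := by
  have hT := hG.1
  obtain ⟨a, b, hab, ⟨hxa, ha5⟩, ⟨hxb, hb5⟩, hva, hvb⟩ := hvtwo
  have hcon : ∀ c, deg G c = 5 → G.Adj x c → G.Adj v c → NextNbr σ v c x ∨ NextNbr σ v x c := by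
    intro c hc hxc hvc
    rcases five_consec hG hc hxc.symm hvc.symm hvx.symm with h | h
    · exact Or.inl (next_rot hT (next_rot hT h))
    · exact Or.inr (next_rot hT h)
  have hpq : ∃ p q, deg G p = 5 ∧ deg G q = 5 ∧ NextNbr σ v p x ∧ NextNbr σ v x q := by
    rcases hcon a ha5 hxa hva with h | h <;> rcases hcon b hb5 hxb hvb with h' | h'
    · exact absurd (next_inj hT h h') hab
    · exact ⟨a, b, ha5, hb5, h, h'⟩
    · exact ⟨b, a, hb5, ha5, h', h⟩
    · exact absurd (next_fun h h') hab
  obtain ⟨p, q, hp5, hq5, hp, hq⟩ := hpq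
  obtain ⟨z, hz0, hz, hinj, hsurj, hper⟩ := enum hT hvx.symm
  rw [hdx] at hinj hper hsurj
  let y : Fin 7 → V := fun i => z i.val
  have hy : Function.Injective y := fun i j h => Fin.ext (hinj i.2 j.2 h)
  have hN : ∀ w, G.Adj x w ↔ ∃ i, y i = w := by
    intro w
    constructor
    · intro h
      obtain ⟨i, hi, h⟩ := hsurj w h
      exact ⟨⟨i, hi⟩, h⟩
    · rintro ⟨i, rfl⟩
      exact (next_adj hT (hz i.val)).1
  have h7 : z 7 = z 0 := hper 0
  have hyn : ∀ i, NextNbr σ x (y i) (y (i + 1)) := by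
    intro i
    have := hz i.val
    fin_cases i
    · exact this
    · exact this
    · exact this
    · exact this
    · exact this
    · exact this
    · have h6 := hz 6
      rw [show 6 + 1 = 7 from rfl, h7] at h6
      exact h6
  have hyy : ∀ i, G.Adj (y i) (y (i + 1)) := fun i => (next_adj hT (hyn i)).2.2
  have hy0 : y 0 = v := hz0
  have hy1 : y 1 = p := by
    have h := hyn 0
    rw [hy0] at h
    exact next_fun h (next_rot hT (next_rot hT hp))
  have hy6 : y 6 = q := by
    have h : NextNbr σ x (y 6) (y 0) := hyn 6
    rw [hy0] at h
    exact next_inj hT h (next_rot hT hq)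
  constructor
  · intro w hw
    rw [next_fun hw hq]
    refine ⟨hq5, ?_⟩
    have h := side hG hdx (y := fun i => y (-i)) (by simpa [hy0] using hv)
      (fun i j h => neg_injective (hy h))
      (fun w => (hN w).trans ⟨fun ⟨i, hi⟩ => ⟨-i, by simpa using hi⟩, fun ⟨i, hi⟩ => ⟨-i, hi⟩⟩)
      (fun i => by
        have h := (hyy (-(i + 1))).symm
        rwa [(by decide : ∀ i : Fin 7, -(i + 1) + 1 = -i) i] at h) h4
      (by rw [← hq5, ← hy6]; rfl) (by rw [← hp5, ← hy1]; rfl)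
    rw [← hy6]
    exact h
  · intro w hw
    rw [next_inj hT hw hp]
    refine ⟨hp5, ?_⟩
    have h := side hG hdx (by rwa [hy0]) hy hN hyy h4 (by rwa [hy1]) (by rwa [hy6])
    rwa [hy1] at h
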